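/- There exist absolute constants C8 > 0 and C9 > 0 such that the following holds. Fix integers p ≥ 1, n ≥ 2, m ≥ n with m ≤ np, a sparsity level s with 2 ≤ s ≤ np, and a number 0 < δ ≤ 1. Let Φ be the random m × (np) multichannel probe matrix built from i.i.d. N(0, 1/m) probe samples. If m ≥ C9 · δ⁻² · s · (log(np))⁶, then ℙ{ ‖I − Φ*Φ‖_s > δ } ≤ C8 · (np)⁻¹. -/

import Mathlib

open MeasureTheory ProbabilityTheory Matrix

/-- The `s`-norm of a square complex matrix: the supremum of `|y* A x|` over index
sets `Γ` of cardinality at most `s` and unit-`ℓ₂`-norm vectors `x, y` supported on `Γ`. -/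
noncomputable def snormS {ι : Type*} [Fintype ι] (s : ℕ) (A : Matrix ι ι ℂ) : ℝ :=
  sSup {r : ℝ | ∃ (Γ : Finset ι) (x y : ι → ℂ),
    Γ.card ≤ s ∧ (∀ i, i ∉ Γ → x i = 0) ∧ (∀ i, i ∉ Γ → y i = 0) ∧
    (∑ i, ‖x i‖ ^ 2) = 1 ∧ (∑ i, ‖y i‖ ^ 2) = 1 ∧
    r = ‖dotProduct (star y) (A.mulVec x)‖}

/-- Law of `p·m` i.i.d. real Gaussian probe samples of mean `0` and variance `1/m`. -/
noncomputable def gaussMeasure (p m : ℕ) : Measure (Fin p → Fin m → ℝ) :=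
  Measure.pi fun _ => Measure.pi fun _ => gaussianReal 0 ((m : NNReal))⁻¹

/-- The `m × (np)` multichannel probe matrix: the `i`-th block is the first `n`
columns of the `m × m` circulant matrix with first row
`(φ_i(n), φ_i(n−1), …, φ_i(1), φ_i(m), …, φ_i(n+1))`. -/
def probeMatrix (p n m : ℕ) (φ : Fin p → Fin m → ℝ) :
    Matrix (Fin m) (Fin p × Fin n) ℝ :=
  Matrix.of fun j ik => φ ik.1 ⟨(n - 1 - (ik.2 : ℕ) + (j : ℕ)) % m, Nat.mod_lt _ j.pos⟩



open MeasureTheory ProbabilityTheory Matrix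

/-! ### Finite probabilistic lemmas -/

lemma aux_exp_le_chord {B f : ℝ} (hB : 0 < B) (hf : |f| ≤ B) :
    Real.exp f ≤ Real.cosh B + f / B * Real.sinh B := by
  have h := abs_le.mp hf
  have hc := convexOn_exp.2 (Set.mem_univ (-B)) (Set.mem_univ B)
    (show 0 ≤ (B - f) / (2 * B) by apply div_nonneg <;> linarith)
    (show 0 ≤ (B + f) / (2 * B) by apply div_nonneg <;> linarith)
    (by field_simp; ring)
  simp only [smul_eq_mul] at hc
  have e1 : (B - f) / (2 * B) * -B + (B + f) / (2 * B) * B = f := by field_simp; ring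
  rw [e1] at hc
  refine hc.trans (le_of_eq ?_)
  rw [Real.cosh_eq, Real.sinh_eq]
  field_simp
  ring

lemma aux_step {α : Type*} [Fintype α] (w f : α → ℝ) (B v : ℝ) (hB : 0 < B)
    (hw : ∀ a, 0 ≤ w a) (hw1 : ∑ a, w a = 1) (hf : ∀ a, |f a| ≤ B) (hm : ∑ a, w a * f a = 0) :
    ∑ a, w a * Real.cosh (v + f a) ≤ Real.cosh v * Real.exp (B ^ 2 / 2) := by
  have key : ∀ a, Real.cosh (v + f a) ≤
      Real.cosh v * Real.cosh B + f a * (Real.sinh v / B * Real.sinh B) := by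
    intro a
    have h1 := aux_exp_le_chord hB (hf a)
    have h2 := aux_exp_le_chord (f := - f a) hB (by rw [abs_neg]; exact hf a)
    have e : Real.cosh (v + f a) =
      (Real.exp v * Real.exp (f a) + Real.exp (-v) * Real.exp (- f a)) / 2 := by
      rw [Real.cosh_eq, ← Real.exp_add, ← Real.exp_add]; congr 3; ring
    rw [e]
    have h3 := mul_le_mul_of_nonneg_left h1 (Real.exp_pos v).le
    have h4 := mul_le_mul_of_nonneg_left h2 (Real.exp_pos (-v)).le
    rw [Real.cosh_eq v, Real.sinh_eq v]
    have : (Real.exp v + Real.exp (-v)) / 2 * Real.cosh B +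
        f a * ((Real.exp v - Real.exp (-v)) / 2 / B * Real.sinh B) =
        (Real.exp v * (Real.cosh B + f a / B * Real.sinh B) +
        Real.exp (-v) * (Real.cosh B + -f a / B * Real.sinh B)) / 2 := by ring
    rw [this]; linarith
  calc ∑ a, w a * Real.cosh (v + f a)
      ≤ ∑ a, w a * (Real.cosh v * Real.cosh B + f a * (Real.sinh v / B * Real.sinh B)) :=
        Finset.sum_le_sum fun a _ => mul_le_mul_of_nonneg_left (key a) (hw a)
    _ = (∑ a, w a) * (Real.cosh v * Real.cosh B)
        + (∑ a, w a * f a) * (Real.sinh v / B * Real.sinh B) := by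
        rw [Finset.sum_mul, Finset.sum_mul, ← Finset.sum_add_distrib]
        exact Finset.sum_congr rfl fun a _ => by ring
    _ = Real.cosh v * Real.cosh B := by rw [hw1, hm]; ring
    _ ≤ _ := mul_le_mul_of_nonneg_left (Real.cosh_le_exp_half_sq B) (Real.cosh_pos v).le

lemma aux_greedy {α J : Type*} [Fintype α] [Fintype J] (w : α → ℝ) (f : J → α → ℝ) (B : ℝ)
    (hB : 0 < B) (hw : ∀ a, 0 ≤ w a) (hw1 : ∑ a, w a = 1) (hf : ∀ j a, |f j a| ≤ B)
    (hm : ∀ j, ∑ a, w a * f j a = 0) (l : ℕ) :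
    ∃ c : Fin l → α, ∑ j, Real.cosh (∑ t, f j (c t)) ≤
      Fintype.card J * Real.exp (l * (B ^ 2 / 2)) := by
  induction l with
  | zero => exact ⟨fun t => t.elim0, by simp⟩
  | succ l ih =>
    obtain ⟨c, hc⟩ := ih
    have hsum : ∑ a, w a * ∑ j, Real.cosh (∑ t, f j (c t) + f j a) ≤
        ∑ a, w a * (Fintype.card J * Real.exp ((l + 1 : ℕ) * (B ^ 2 / 2))) := by
      rw [← Finset.sum_mul, hw1, one_mul]
      calc ∑ a, w a * ∑ j, Real.cosh (∑ t, f j (c t) + f j a)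
          = ∑ j, ∑ a, w a * Real.cosh (∑ t, f j (c t) + f j a) := by
            simp_rw [Finset.mul_sum]; exact Finset.sum_comm
        _ ≤ ∑ j, Real.cosh (∑ t, f j (c t)) * Real.exp (B ^ 2 / 2) :=
            Finset.sum_le_sum fun j _ => aux_step w (f j) B _ hB hw hw1 (hf j) (hm j)
        _ = (∑ j, Real.cosh (∑ t, f j (c t))) * Real.exp (B ^ 2 / 2) := by rw [Finset.sum_mul]
        _ ≤ (Fintype.card J * Real.exp (l * (B ^ 2 / 2))) * Real.exp (B ^ 2 / 2) :=
            mul_le_mul_of_nonneg_right hc (Real.exp_pos _).le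
        _ = _ := by rw [mul_assoc, ← Real.exp_add]; congr 2; push_cast; ring
    by_contra hcon
    push Not at hcon
    have hlt : ∀ a, Fintype.card J * Real.exp ((l + 1 : ℕ) * (B ^ 2 / 2)) <
        ∑ j, Real.cosh (∑ t, f j (c t) + f j a) := by
      intro a
      have := hcon (Fin.snoc c a)
      simpa [Fin.sum_univ_castSucc] using this
    have hex : ∃ a, 0 < w a := by
      by_contra h
      push Not at h
      have : ∑ a, w a ≤ 0 := Finset.sum_nonpos fun a _ => h a
      linarith
    obtain ⟨a0, ha0⟩ := hex
    have : ∑ a, w a * (Fintype.card J * Real.exp ((l + 1 : ℕ) * (B ^ 2 / 2))) <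
        ∑ a, w a * ∑ j, Real.cosh (∑ t, f j (c t) + f j a) :=
      Finset.sum_lt_sum (fun a _ => mul_le_mul_of_nonneg_left (hlt a).le (hw a))
        ⟨a0, Finset.mem_univ _, mul_lt_mul_of_pos_left (hlt a0) ha0⟩
    linarith

/-- abstract Maurey lemma; `r` is an upper bound for the logarithm of the number of functionals -/
lemma aux_maurey {α J : Type*} [Fintype α] [Fintype J] (w : α → ℝ) (f : J → α → ℝ) (B r : ℝ)
    (hB : 0 < B) (hw : ∀ a, 0 ≤ w a) (hw1 : ∑ a, w a = 1) (hf : ∀ j a, |f j a| ≤ B)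
    (hm : ∀ j, ∑ a, w a * f j a = 0) (l : ℕ) (hl : 0 < l) (hr : 0 < r)
    (hJ : 2 * (Fintype.card J : ℝ) ≤ Real.exp r) :
    ∃ c : Fin l → α, ∀ j, |∑ t, f j (c t)| ≤ B * Real.sqrt (2 * l * r) := by
  have hl' : (0 : ℝ) < l := by exact_mod_cast hl
  set lam : ℝ := Real.sqrt (2 * r / l) / B with hlam
  have hlam0 : 0 < lam := by positivity
  have hlam2 : lam ^ 2 * B ^ 2 = 2 * r / l := by
    rw [hlam, div_pow, Real.sq_sqrt (by positivity)]; field_simp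
  obtain ⟨c, hc⟩ := aux_greedy w (fun j a => lam * f j a) (lam * B) (by positivity) hw hw1
    (fun j a => by rw [abs_mul, abs_of_pos hlam0]; exact mul_le_mul_of_nonneg_left (hf j a) hlam0.le)
    (fun j => by
      have : ∑ a, w a * (lam * f j a) = lam * ∑ a, w a * f j a := by
        rw [Finset.mul_sum]; exact Finset.sum_congr rfl fun a _ => by ring
      rw [this, hm, mul_zero]) l
  refine ⟨c, fun j => ?_⟩
  have h1 : Real.cosh (∑ t, lam * f j (c t)) ≤ ∑ j, Real.cosh (∑ t, lam * f j (c t)) :=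
    Finset.single_le_sum (f := fun j => Real.cosh (∑ t, lam * f j (c t)))
      (fun j _ => (Real.cosh_pos _).le) (Finset.mem_univ j)
  rw [← Finset.mul_sum] at h1
  set z := ∑ t, f j (c t)
  have h2 : Real.exp (lam * |z|) ≤ 2 * Real.cosh (lam * z) := by
    rw [← Real.cosh_abs, abs_mul, abs_of_pos hlam0, Real.cosh_eq]
    have := Real.exp_pos (-(lam * |z|)); linarith
  have h3 : (l : ℝ) * ((lam * B) ^ 2 / 2) = r := by
    rw [mul_pow, hlam2]; field_simp
  rw [h3] at hc
  have h4 : Real.exp (lam * |z|) ≤ Real.exp (2 * r) := by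
    rw [two_mul r, Real.exp_add]
    calc _ ≤ _ := h2
      _ ≤ 2 * (Fintype.card J * Real.exp r) := by linarith
      _ ≤ _ := by rw [← mul_assoc]; exact mul_le_mul_of_nonneg_right hJ (Real.exp_pos _).le
  have h5 := Real.exp_le_exp.mp h4
  have h6 : lam * (B * Real.sqrt (2 * l * r)) = 2 * r := by
    have : Real.sqrt (2 * r / l) * Real.sqrt (2 * l * r) = 2 * r := by
      rw [← Real.sqrt_mul (by positivity)]
      rw [show 2 * r / l * (2 * l * r) = (2 * r) ^ 2 by field_simp]
      exact Real.sqrt_sq (by positivity)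
    have e : ∀ u v : ℝ, u / B * (B * v) = u * v := fun u v => by field_simp
    rw [hlam, e, this]
  rw [← h6] at h5
  exact le_of_mul_le_mul_left h5 hlam0

/-- value of a code letter under a functional -/
def cval {ι : Type*} (b : ι → ℝ) : Option (ι × Bool) → ℝ
  | none => 0
  | some (i, true) => b i
  | some (i, false) => - b i

lemma aux_maurey2 {ι J : Type*} [Fintype ι] [Fintype J] (a : J → ι → ℝ) (K S r : ℝ)
    (hK : 0 < K) (hS : 0 < S) (ha : ∀ j i, |a j i| ≤ K) (x : ι → ℝ) (hx : ∑ i, |x i| ≤ S)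
    (l : ℕ) (hl : 0 < l) (hr : 0 < r) (hJ : 2 * (Fintype.card J : ℝ) ≤ Real.exp r) :
    ∃ c : Fin l → Option (ι × Bool), ∀ j,
      |∑ i, a j i * x i - S / l * ∑ t, cval (a j) (c t)| ≤ 2 * S * K * Real.sqrt (2 * r / l) := by
  have hl' : (0 : ℝ) < l := by exact_mod_cast hl
  let w : Option (ι × Bool) → ℝ := fun o => match o with
    | none => 1 - (∑ i, |x i|) / S
    | some (i, true) => max (x i) 0 / S
    | some (i, false) => max (-x i) 0 / S
  have hax : ∀ j, |∑ i, a j i * x i| ≤ S * K := by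
    intro j
    calc |∑ i, a j i * x i| ≤ ∑ i, |a j i * x i| := Finset.abs_sum_le_sum_abs _ _
      _ ≤ ∑ i, K * |x i| := Finset.sum_le_sum fun i _ => by
          rw [abs_mul]; exact mul_le_mul_of_nonneg_right (ha j i) (abs_nonneg _)
      _ = K * ∑ i, |x i| := by rw [Finset.mul_sum]
      _ ≤ K * S := mul_le_mul_of_nonneg_left hx hK.le
      _ = S * K := mul_comm _ _
  have hmm : ∀ i, max (x i) 0 + max (-x i) 0 = |x i| := by
    intro i
    rcases le_total 0 (x i) with h | h
    · rw [max_eq_left h, max_eq_right (by linarith), abs_of_nonneg h, add_zero]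
    · rw [max_eq_right h, max_eq_left (by linarith), abs_of_nonpos h, zero_add]
  have hmd : ∀ i, max (x i) 0 - max (-x i) 0 = x i := by
    intro i
    rcases le_total 0 (x i) with h | h
    · rw [max_eq_left h, max_eq_right (by linarith)]; ring
    · rw [max_eq_right h, max_eq_left (by linarith)]; ring
  have hw1 : ∑ o, w o = 1 := by
    rw [Fintype.sum_option, Fintype.sum_prod_type]
    simp only [Fintype.sum_bool, w]
    have : ∀ i, max (x i) 0 / S + max (-x i) 0 / S = |x i| / S := fun i => by
      rw [← add_div, hmm]
    simp only [this, ← Finset.sum_div]; ring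
  have hwm : ∀ j, ∑ o, w o * cval (a j) o = (∑ i, a j i * x i) / S := by
    intro j
    rw [Fintype.sum_option, Fintype.sum_prod_type]
    simp only [Fintype.sum_bool, w, cval, mul_zero, zero_add]
    rw [Finset.sum_div]
    refine Finset.sum_congr rfl fun i _ => ?_
    conv_rhs => rw [← hmd i]
    ring
  have hcv : ∀ j o, |cval (a j) o| ≤ K := by
    intro j o
    rcases o with _ | ⟨i, _ | _⟩
    · simpa [cval] using hK.le
    · simpa [cval] using ha j i
    · simpa [cval] using ha j i
  obtain ⟨c, hc⟩ := aux_maurey w (fun j o => S * cval (a j) o - ∑ i, a j i * x i) (2 * S * K) r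
    (by positivity)
    (by
      intro o
      rcases o with _ | ⟨i, _ | _⟩
      · simp only [w]; rw [sub_nonneg, div_le_one hS]; exact hx
      · simp only [w]; positivity
      · simp only [w]; positivity)
    hw1
    (by
      intro j o
      have h1 := hax j
      have h2 : |S * cval (a j) o| ≤ S * K := by
        rw [abs_mul, abs_of_pos hS]; exact mul_le_mul_of_nonneg_left (hcv j o) hS.le
      calc _ ≤ |S * cval (a j) o| + |∑ i, a j i * x i| := abs_sub _ _
        _ ≤ _ := by linarith)
    (by
      intro j
      have : ∑ o, w o * (S * cval (a j) o - ∑ i, a j i * x i) =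
          S * ∑ o, w o * cval (a j) o - (∑ o, w o) * ∑ i, a j i * x i := by
        rw [Finset.mul_sum, Finset.sum_mul, ← Finset.sum_sub_distrib]
        exact Finset.sum_congr rfl fun o _ => by ring
      rw [this, hwm, hw1]; field_simp; ring)
    l hl hr hJ
  refine ⟨c, fun j => ?_⟩
  have h := hc j
  rw [Finset.sum_sub_distrib, ← Finset.mul_sum, Finset.sum_const, Finset.card_univ,
    Fintype.card_fin, nsmul_eq_mul] at h
  have e : ∑ i, a j i * x i - S / l * ∑ t, cval (a j) (c t) =
      -((S * ∑ t, cval (a j) (c t) - l * ∑ i, a j i * x i) / l) := by field_simp; ring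
  rw [e, abs_neg, abs_div, abs_of_pos hl', div_le_iff₀ hl']
  refine h.trans (le_of_eq ?_)
  have : Real.sqrt (2 * l * r) = Real.sqrt (2 * r / l) * l := by
    rw [show 2 * l * r = 2 * r / l * (l : ℝ) ^ 2 by field_simp,
      Real.sqrt_mul (by positivity), Real.sqrt_sq hl'.le]
  rw [this]; ring

open MeasureTheory ProbabilityTheory Matrix

/-! ### Rademacher sums -/

def sg : Bool → ℝ
  | true => 1
  | false => -1

lemma aux_rad_exp {C : Type*} [Fintype C] [DecidableEq C] (v : C → ℝ) :
    ∑ η : C → Bool, Real.exp (∑ c, sg (η c) * v c) ≤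
      2 ^ Fintype.card C * Real.exp ((∑ c, v c ^ 2) / 2) := by
  have h1 : ∑ η : C → Bool, Real.exp (∑ c, sg (η c) * v c) = ∏ c, ∑ b : Bool, Real.exp (sg b * v c) := by
    rw [Finset.prod_univ_sum]
    simp only [Fintype.piFinset_univ, Real.exp_sum]
  rw [h1]
  have h2 : ∀ c, ∑ b : Bool, Real.exp (sg b * v c) = 2 * Real.cosh (v c) := by
    intro c; rw [Fintype.sum_bool, Real.cosh_eq]; simp [sg]; ring
  simp only [h2]
  rw [Finset.prod_mul_distrib, Finset.prod_const, Finset.card_univ, Finset.sum_div, Real.exp_sum]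
  refine mul_le_mul_of_nonneg_left ?_ (by positivity)
  exact Finset.prod_le_prod (fun c _ => (Real.cosh_pos _).le) fun c _ => Real.cosh_le_exp_half_sq _

/-- pointwise bound of an even power by exponentials -/
lemma aux_pow_le_exp (z D : ℝ) (r : ℕ) (hr : 1 ≤ r) (hD : 0 < D) :
    z ^ (2 * r) ≤ (2 * r * D) ^ r *
      (Real.exp (Real.sqrt (2 * r / D) * z) + Real.exp (-(Real.sqrt (2 * r / D) * z))) := by
  have hr' : (0 : ℝ) < r := by exact_mod_cast hr
  set lam := Real.sqrt (2 * r / D) with hlam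
  have hl0 : 0 < lam := by positivity
  have hl2 : lam ^ 2 = 2 * r / D := Real.sq_sqrt (by positivity)
  have h1 := Real.pow_div_factorial_le_exp (|lam * z|) (abs_nonneg _) (2 * r)
  have h2 : Real.exp |lam * z| ≤ Real.exp (lam * z) + Real.exp (-(lam * z)) := by
    rcases abs_cases (lam * z) with h | h
    · rw [h.1]; linarith [Real.exp_pos (-(lam * z))]
    · rw [h.1]; linarith [Real.exp_pos (lam * z)]
  rw [(even_two_mul r).pow_abs] at h1
  have hf : (0 : ℝ) < (2 * r).factorial := by positivity
  rw [div_le_iff₀ hf, mul_pow] at h1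
  have h3 : ((2 * r).factorial : ℝ) ≤ (2 * r) ^ (2 * r) := by
    exact_mod_cast Nat.factorial_le_pow (2 * r)
  have h4 : lam ^ (2 * r) = (2 * r / D) ^ r := by rw [pow_mul, hl2]
  have h5 : (2 * r * D) ^ r * lam ^ (2 * r) = (2 * r : ℝ) ^ (2 * r) := by
    rw [h4, ← mul_pow, pow_mul]; congr 1; field_simp
  have h6 : lam ^ (2 * r) * z ^ (2 * r) ≤ lam ^ (2 * r) * ((2 * r * D) ^ r *
      (Real.exp (lam * z) + Real.exp (-(lam * z)))) := by
    calc _ ≤ _ := h1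
      _ ≤ (Real.exp (lam * z) + Real.exp (-(lam * z))) * (2 * r) ^ (2 * r) := by gcongr
      _ = _ := by rw [← h5]; ring
  exact le_of_mul_le_mul_left h6 (by positivity)

lemma aux_two_exp_le (r : ℕ) (hr : 1 ≤ r) : 2 * Real.exp r ≤ 8 ^ r := by
  have h1 : Real.exp r = Real.exp 1 ^ r := by rw [← Real.exp_nat_mul, mul_one]
  have h2 : Real.exp 1 ≤ 4 := by linarith [Real.exp_one_lt_d9]
  have h3 : (2 : ℝ) ≤ 2 ^ r := by
    calc (2 : ℝ) = 2 ^ 1 := by norm_num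
      _ ≤ 2 ^ r := pow_le_pow_right₀ (by norm_num) hr
  rw [h1]
  calc 2 * Real.exp 1 ^ r ≤ 2 ^ r * 4 ^ r := by gcongr
    _ = 8 ^ r := by rw [← mul_pow]; norm_num

lemma aux_rad_moment {C : Type*} [Fintype C] [DecidableEq C] (v : C → ℝ) (D : ℝ) (r : ℕ)
    (hr : 1 ≤ r) (hD : 0 < D) (hv : ∑ c, v c ^ 2 ≤ D) :
    ∑ η : C → Bool, (∑ c, sg (η c) * v c) ^ (2 * r) ≤
      2 ^ Fintype.card C * (16 * r * D) ^ r := by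
  have hr' : (0 : ℝ) < r := by exact_mod_cast hr
  set lam := Real.sqrt (2 * r / D) with hlam
  have hl2 : lam ^ 2 = 2 * r / D := Real.sq_sqrt (by positivity)
  have key : ∀ t : ℝ, t ^ 2 = lam ^ 2 → ∑ η : C → Bool, Real.exp (t * ∑ c, sg (η c) * v c) ≤
      2 ^ Fintype.card C * Real.exp r := by
    intro t ht
    have h := aux_rad_exp (fun c => t * v c)
    have e : ∀ η : C → Bool, t * ∑ c, sg (η c) * v c = ∑ c, sg (η c) * (t * v c) := by
      intro η; rw [Finset.mul_sum]; exact Finset.sum_congr rfl fun c _ => by ring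
    simp only [e]
    refine h.trans ?_
    gcongr
    simp only [mul_pow]
    rw [← Finset.mul_sum, ht, hl2]
    calc (2 * r / D * ∑ i, v i ^ 2) / 2 ≤ 2 * r / D * D / 2 := by gcongr
      _ = r := by field_simp
  calc ∑ η : C → Bool, (∑ c, sg (η c) * v c) ^ (2 * r)
      ≤ ∑ η : C → Bool, (2 * r * D) ^ r * (Real.exp (lam * ∑ c, sg (η c) * v c) +
          Real.exp ((-lam) * ∑ c, sg (η c) * v c)) :=
        Finset.sum_le_sum fun η _ => by
          have := aux_pow_le_exp (∑ c, sg (η c) * v c) D r hr hD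
          rw [neg_mul]; exact this
    _ = (2 * r * D) ^ r * (∑ η : C → Bool, Real.exp (lam * ∑ c, sg (η c) * v c) +
          ∑ η : C → Bool, Real.exp ((-lam) * ∑ c, sg (η c) * v c)) := by
        rw [← Finset.sum_add_distrib, Finset.mul_sum]
    _ ≤ (2 * r * D) ^ r * (2 ^ Fintype.card C * Real.exp r + 2 ^ Fintype.card C * Real.exp r) := by
        gcongr
        · exact key lam rfl
        · exact key (-lam) (by ring)
    _ = (2 * r * D) ^ r * 2 ^ Fintype.card C * (2 * Real.exp r) := by ring
    _ ≤ (2 * r * D) ^ r * 2 ^ Fintype.card C * 8 ^ r := by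
        gcongr; exact aux_two_exp_le r hr
    _ = _ := by
        rw [show 16 * (r : ℝ) * D = (2 * r * D) * 8 by ring, mul_pow (2 * (r : ℝ) * D) 8 r]
        generalize (2 * (r : ℝ) * D) ^ r = u
        ring

open MeasureTheory ProbabilityTheory Matrix

/-! ### Chaining -/

lemma aux_pow_sum_le {β : Type*} (s : Finset β) (f : β → ℝ) (hf : ∀ b ∈ s, 0 ≤ f b) (l : ℕ)
    (hl : 1 ≤ l) : (∑ b ∈ s, f b) ^ l ≤ (s.card : ℝ) ^ (l - 1) * ∑ b ∈ s, f b ^ l := by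
  obtain ⟨k, rfl⟩ : ∃ k, l = k + 1 := ⟨l - 1, by omega⟩
  rcases s.eq_empty_or_nonempty with h | h
  · subst h; simp
  have := pow_sum_div_card_le_sum_pow (s := s) (f := f) hf k
  have hc : (0 : ℝ) < s.card := by exact_mod_cast h.card_pos
  rw [div_le_iff₀ (by positivity)] at this
  simp only [Nat.add_sub_cancel]
  linarith

lemma aux_level {C β : Type*} [Fintype C] [DecidableEq C] (P : Finset β) (v : β → C → ℝ)
    (D M : ℝ) (r l : ℕ) (hr : 1 ≤ r) (hl : 1 ≤ l) (hD : 0 < D) (hM : 0 ≤ M)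
    (hP : (P.card : ℝ) ≤ M ^ l) (hv : ∀ b ∈ P, ∑ c, v b c ^ 2 ≤ D)
    (b : (C → Bool) → β) (hb : ∀ η, b η ∈ P) :
    ∑ η : C → Bool, (∑ c, sg (η c) * v (b η) c) ^ (2 * r) ≤
      2 ^ Fintype.card C * (M * (16 * r * l * D) ^ r) := by
  have hG : (Finset.univ : Finset (C → Bool)).card = 2 ^ Fintype.card C := by simp
  have h1 := aux_pow_sum_le (Finset.univ : Finset (C → Bool))
    (fun η => (∑ c, sg (η c) * v (b η) c) ^ (2 * r)) (fun η _ => (even_two_mul r).pow_nonneg _) l hl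
  rw [hG] at h1
  have hev : Even (2 * (r * l)) := even_two_mul _
  have h2 : ∑ η : C → Bool, ((∑ c, sg (η c) * v (b η) c) ^ (2 * r)) ^ l ≤
      2 ^ Fintype.card C * (M ^ l * (16 * r * l * D) ^ (r * l)) := by
    calc ∑ η : C → Bool, ((∑ c, sg (η c) * v (b η) c) ^ (2 * r)) ^ l
        ≤ ∑ η : C → Bool, ∑ b ∈ P, (∑ c, sg (η c) * v b c) ^ (2 * (r * l)) := by
          refine Finset.sum_le_sum fun η _ => ?_
          rw [← pow_mul, mul_assoc]
          exact Finset.single_le_sum (f := fun b => (∑ c, sg (η c) * v b c) ^ (2 * (r * l)))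
            (fun b _ => hev.pow_nonneg _) (hb η)
      _ = ∑ b ∈ P, ∑ η : C → Bool, (∑ c, sg (η c) * v b c) ^ (2 * (r * l)) := Finset.sum_comm
      _ ≤ ∑ b ∈ P, 2 ^ Fintype.card C * (16 * (r * l : ℕ) * D) ^ (r * l) :=
          Finset.sum_le_sum fun b hb => aux_rad_moment (v b) D (r * l)
            (Nat.one_le_iff_ne_zero.mpr (by positivity)) hD (hv b hb)
      _ = P.card * (2 ^ Fintype.card C * (16 * r * l * D) ^ (r * l)) := by
          rw [Finset.sum_const, nsmul_eq_mul]; push_cast; ring_nf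
      _ ≤ M ^ l * (2 ^ Fintype.card C * (16 * r * l * D) ^ (r * l)) := by gcongr
      _ = _ := by ring
  have h3 : (∑ η : C → Bool, (∑ c, sg (η c) * v (b η) c) ^ (2 * r)) ^ l ≤
      (2 ^ Fintype.card C * (M * (16 * r * l * D) ^ r)) ^ l := by
    refine h1.trans ?_
    push_cast
    calc _ ≤ ((2 : ℝ) ^ Fintype.card C) ^ (l - 1) *
          (2 ^ Fintype.card C * (M ^ l * (16 * r * l * D) ^ (r * l))) := by gcongr
      _ = ((2 : ℝ) ^ Fintype.card C) ^ (l - 1 + 1) * (M ^ l * (16 * r * l * D) ^ (r * l)) := by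
          rw [pow_succ]; ring
      _ = _ := by
          rw [Nat.sub_add_cancel hl, pow_mul (16 * (r : ℝ) * l * D)]
          generalize (16 * (r : ℝ) * l * D) ^ r = u
          rw [mul_pow, mul_pow]
  exact le_of_pow_le_pow_left₀ (by omega) (by positivity) h3

lemma aux_net {ι J : Type*} [Fintype ι] [Fintype J] (a : J → ι → ℝ) (K S : ℝ) (r : ℕ)
    (hK : 0 < K) (hS : 0 < S) (ha : ∀ j i, |a j i| ≤ K) (T : Set (ι → ℝ)) (h0 : 0 ∈ T)
    (hT : ∀ x ∈ T, ∑ i, |x i| ≤ S) (hr : 1 ≤ r)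
    (hJ : 2 * (Fintype.card J : ℝ) ≤ Real.exp (3 * r)) (k : ℕ) :
    ∃ (A : Finset (ι → ℝ)) (π : (ι → ℝ) → (ι → ℝ)), A.card ≤ (2 * Fintype.card ι + 1) ^ (2 ^ k) ∧
      (∀ x ∈ T, π x ∈ A ∧ π x ∈ T ∧
        ∀ j, |a j ⬝ᵥ (x - π x)| ≤ 4 * S * K * Real.sqrt (6 * r / 2 ^ k)) ∧
      (k = 0 → ∀ x, π x = 0) := by
  classical
  have hr' : (1 : ℝ) ≤ r := by exact_mod_cast hr
  rcases Nat.eq_zero_or_pos k with hk | hk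
  · subst hk
    refine ⟨{0}, fun _ => 0, by simp, ?_, fun _ _ => rfl⟩
    intro x hx
    refine ⟨by simp, h0, fun j => ?_⟩
    have h1 : |a j ⬝ᵥ x| ≤ S * K := by
      calc |a j ⬝ᵥ x| ≤ ∑ i, |a j i * x i| := Finset.abs_sum_le_sum_abs _ _
        _ ≤ ∑ i, K * |x i| := Finset.sum_le_sum fun i _ => by
            rw [abs_mul]; exact mul_le_mul_of_nonneg_right (ha j i) (abs_nonneg _)
        _ = K * ∑ i, |x i| := by rw [Finset.mul_sum]
        _ ≤ K * S := mul_le_mul_of_nonneg_left (hT x hx) hK.le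
        _ = S * K := mul_comm _ _
    rw [sub_zero]
    have h2 : (1 : ℝ) ≤ Real.sqrt (6 * r / 2 ^ 0) := by
      rw [Real.one_le_sqrt]; norm_num; linarith
    have h3 : 0 < S * K := by positivity
    nlinarith
  · have hch : ∀ x : ι → ℝ, ∃ c : Fin (2 ^ k) → Option (ι × Bool), x ∈ T → ∀ j,
        |a j ⬝ᵥ x - S / (2 ^ k : ℕ) * ∑ t, cval (a j) (c t)| ≤
          2 * S * K * Real.sqrt (2 * (3 * r) / (2 ^ k : ℕ)) := by
      intro x
      by_cases hx : x ∈ T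
      · obtain ⟨c, hc⟩ := aux_maurey2 a K S (3 * r) hK hS ha x (hT x hx) (2 ^ k) (by positivity)
          (by positivity) hJ
        exact ⟨c, fun _ => hc⟩
      · exact ⟨fun _ => none, fun h => absurd h hx⟩
    choose code hcode using hch
    let g : (Fin (2 ^ k) → Option (ι × Bool)) → (ι → ℝ) := fun c =>
      if h : ∃ x ∈ T, code x = c then h.choose else 0
    have hg : ∀ x ∈ T, g (code x) ∈ T ∧ code (g (code x)) = code x := by
      intro x hx
      have h : ∃ y ∈ T, code y = code x := ⟨x, hx, rfl⟩
      have e : g (code x) = h.choose := dif_pos h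
      rw [e]; exact h.choose_spec
    refine ⟨Finset.univ.image g, fun x => g (code x), ?_, ?_, fun h => by omega⟩
    · refine Finset.card_image_le.trans ?_
      rw [Finset.card_univ, Fintype.card_fun, Fintype.card_option, Fintype.card_prod,
        Fintype.card_bool, Fintype.card_fin, mul_comm (Fintype.card ι)]
    · intro x hx
      obtain ⟨h1, h2⟩ := hg x hx
      refine ⟨Finset.mem_image_of_mem _ (Finset.mem_univ _), h1, fun j => ?_⟩
      have h3 := hcode x hx j
      have h4 := hcode _ h1 j
      rw [h2] at h4
      rw [dotProduct_sub]
      have e : (2 * (3 * r) / (2 ^ k : ℕ) : ℝ) = 6 * r / 2 ^ k := by push_cast; ring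
      rw [e] at h3 h4
      rw [abs_le] at h3 h4 ⊢
      constructor <;> linarith [h3.1, h3.2, h4.1, h4.2]

lemma aux_incr {ι J C : Type*} [Fintype ι] [Fintype J] [Fintype C] [DecidableEq C]
    (a : J → ι → ℝ) (ρ : J → C) (hρ : ∀ c, (Finset.univ.filter fun j => ρ j = c).card ≤ 4)
    (R2 ε : ℝ)  (y z : ι → ℝ)
    (hy : ∑ j, (a j ⬝ᵥ y) ^ 2 ≤ R2) (hz : ∑ j, (a j ⬝ᵥ z) ^ 2 ≤ R2)
    (hyz : ∀ j, |a j ⬝ᵥ (y - z)| ≤ ε) :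
    ∑ c, (∑ j ∈ Finset.univ.filter (fun j => ρ j = c),
      ((a j ⬝ᵥ y) ^ 2 - (a j ⬝ᵥ z) ^ 2)) ^ 2 ≤ 16 * ε ^ 2 * R2 := by
  have h1 : ∀ j, ((a j ⬝ᵥ y) ^ 2 - (a j ⬝ᵥ z) ^ 2) ^ 2 ≤
      ε ^ 2 * (2 * (a j ⬝ᵥ y) ^ 2 + 2 * (a j ⬝ᵥ z) ^ 2) := by
    intro j
    have h := hyz j
    rw [dotProduct_sub] at h
    have h2 : (a j ⬝ᵥ y - a j ⬝ᵥ z) ^ 2 ≤ ε ^ 2 := by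
      rw [← sq_abs]; exact pow_le_pow_left₀ (abs_nonneg _) h 2
    calc ((a j ⬝ᵥ y) ^ 2 - (a j ⬝ᵥ z) ^ 2) ^ 2
        = (a j ⬝ᵥ y - a j ⬝ᵥ z) ^ 2 * (a j ⬝ᵥ y + a j ⬝ᵥ z) ^ 2 := by ring
      _ ≤ ε ^ 2 * (2 * (a j ⬝ᵥ y) ^ 2 + 2 * (a j ⬝ᵥ z) ^ 2) := by
          apply mul_le_mul h2 _ (sq_nonneg _) (sq_nonneg _)
          nlinarith [sq_nonneg (a j ⬝ᵥ y - a j ⬝ᵥ z)]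
  calc _ ≤ ∑ c, 4 * ∑ j ∈ Finset.univ.filter (fun j => ρ j = c),
        ((a j ⬝ᵥ y) ^ 2 - (a j ⬝ᵥ z) ^ 2) ^ 2 := by
        refine Finset.sum_le_sum fun c _ => ?_
        refine sq_sum_le_card_mul_sum_sq.trans ?_
        refine mul_le_mul_of_nonneg_right ?_ (Finset.sum_nonneg fun _ _ => sq_nonneg _)
        exact_mod_cast hρ c
    _ = 4 * ∑ j, ((a j ⬝ᵥ y) ^ 2 - (a j ⬝ᵥ z) ^ 2) ^ 2 := by
        rw [← Finset.mul_sum, Finset.sum_fiberwise]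
    _ ≤ 4 * ∑ j, ε ^ 2 * (2 * (a j ⬝ᵥ y) ^ 2 + 2 * (a j ⬝ᵥ z) ^ 2) := by
        gcongr with j _; exact h1 j
    _ = 4 * (ε ^ 2 * (2 * ∑ j, (a j ⬝ᵥ y) ^ 2 + 2 * ∑ j, (a j ⬝ᵥ z) ^ 2)) := by
        rw [← Finset.mul_sum, Finset.sum_add_distrib, Finset.mul_sum, Finset.mul_sum]
    _ ≤ 4 * (ε ^ 2 * (2 * R2 + 2 * R2)) := by gcongr
    _ = _ := by ring

lemma aux_Z_sub {ι J C : Type*} [Fintype ι] [Fintype J] [Fintype C] [DecidableEq C]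
    (a : J → ι → ℝ) (ρ : J → C) (η : C → Bool) (y z : ι → ℝ) :
    ∑ j, sg (η (ρ j)) * (a j ⬝ᵥ y) ^ 2 - ∑ j, sg (η (ρ j)) * (a j ⬝ᵥ z) ^ 2 =
    ∑ c, sg (η c) * ∑ j ∈ Finset.univ.filter (fun j => ρ j = c),
      ((a j ⬝ᵥ y) ^ 2 - (a j ⬝ᵥ z) ^ 2) := by
  rw [← Finset.sum_sub_distrib, ← Finset.sum_fiberwise Finset.univ ρ]
  refine Finset.sum_congr rfl fun c _ => ?_
  rw [Finset.mul_sum]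
  refine Finset.sum_congr rfl fun j hj => ?_
  rw [(Finset.mem_filter.mp hj).2]; ring

lemma sg_abs (b : Bool) : |sg b| = 1 := by cases b <;> simp [sg]

lemma aux_rem {ι J C : Type*} [Fintype ι] [Fintype J]
    (a : J → ι → ℝ) (ρ : J → C) (η : C → Bool)
    (R2 ε : ℝ)  (y z : ι → ℝ)
    (hy : ∑ j, (a j ⬝ᵥ y) ^ 2 ≤ R2) (hz : ∑ j, (a j ⬝ᵥ z) ^ 2 ≤ R2)
    (hyz : ∀ j, |a j ⬝ᵥ (y - z)| ≤ ε) :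
    (∑ j, sg (η (ρ j)) * (a j ⬝ᵥ y) ^ 2 - ∑ j, sg (η (ρ j)) * (a j ⬝ᵥ z) ^ 2) ^ 2 ≤
      Fintype.card J * (4 * ε ^ 2 * R2) := by
  rw [← Finset.sum_sub_distrib]
  refine sq_sum_le_card_mul_sum_sq.trans ?_
  rw [Finset.card_univ]
  refine mul_le_mul_of_nonneg_left ?_ (by positivity)
  have h1 : ∀ j, (sg (η (ρ j)) * (a j ⬝ᵥ y) ^ 2 - sg (η (ρ j)) * (a j ⬝ᵥ z) ^ 2) ^ 2 ≤
      ε ^ 2 * (2 * (a j ⬝ᵥ y) ^ 2 + 2 * (a j ⬝ᵥ z) ^ 2) := by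
    intro j
    have h := hyz j
    rw [dotProduct_sub] at h
    have h2 : (a j ⬝ᵥ y - a j ⬝ᵥ z) ^ 2 ≤ ε ^ 2 := by
      rw [← sq_abs]; exact pow_le_pow_left₀ (abs_nonneg _) h 2
    have h3 : sg (η (ρ j)) ^ 2 = 1 := by rw [← sq_abs, sg_abs]; norm_num
    calc _ = sg (η (ρ j)) ^ 2 *
          ((a j ⬝ᵥ y - a j ⬝ᵥ z) ^ 2 * (a j ⬝ᵥ y + a j ⬝ᵥ z) ^ 2) := by ring
      _ ≤ ε ^ 2 * (2 * (a j ⬝ᵥ y) ^ 2 + 2 * (a j ⬝ᵥ z) ^ 2) := by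
          rw [h3, one_mul]
          apply mul_le_mul h2 _ (sq_nonneg _) (sq_nonneg _)
          nlinarith [sq_nonneg (a j ⬝ᵥ y - a j ⬝ᵥ z)]
  calc _ ≤ ∑ j, ε ^ 2 * (2 * (a j ⬝ᵥ y) ^ 2 + 2 * (a j ⬝ᵥ z) ^ 2) :=
        Finset.sum_le_sum fun j _ => h1 j
    _ = (ε ^ 2 * (2 * ∑ j, (a j ⬝ᵥ y) ^ 2 + 2 * ∑ j, (a j ⬝ᵥ z) ^ 2)) := by
        rw [← Finset.mul_sum, Finset.sum_add_distrib, Finset.mul_sum, Finset.mul_sum]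
    _ ≤ (ε ^ 2 * (2 * R2 + 2 * R2)) := by gcongr
    _ = _ := by ring

lemma aux_exp9 (r : ℕ) : Real.exp (9 * r) ≤ (10 ^ 4) ^ r := by
  have h1 : Real.exp (9 * r) = (Real.exp 1 ^ 9) ^ r := by
    rw [← Real.exp_nat_mul, ← Real.exp_nat_mul]; congr 1; push_cast; ring
  rw [h1]
  have h2 : Real.exp 1 ≤ 2.72 := by linarith [Real.exp_one_lt_d9]
  have h3 : Real.exp 1 ^ 9 ≤ 10 ^ 4 := by
    calc Real.exp 1 ^ 9 ≤ 2.72 ^ 9 := by gcongr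
      _ ≤ 10 ^ 4 := by norm_num
  gcongr

theorem aux_chain {ι J C : Type*} [Fintype ι] [Fintype J] [Fintype C] [DecidableEq C]
    (a : J → ι → ℝ) (ρ : J → C) (hρ : ∀ c, (Finset.univ.filter fun j => ρ j = c).card ≤ 4)
    (K S R2 : ℝ) (r : ℕ) (hK : 0 < K) (hS : 0 < S) (hR : 0 < R2) (ha : ∀ j i, |a j i| ≤ K)
    (T : Set (ι → ℝ)) (h0 : 0 ∈ T) (hT : ∀ x ∈ T, ∑ i, |x i| ≤ S)
    (hTR : ∀ x ∈ T, ∑ j, (a j ⬝ᵥ x) ^ 2 ≤ R2) (hr : 1 ≤ r)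
    (hJ : 2 * (Fintype.card J : ℝ) ≤ Real.exp (3 * r))
    (hM : (2 * (Fintype.card ι : ℝ) + 1) ≤ Real.exp (3 * r))
    (x : (C → Bool) → (ι → ℝ)) (hx : ∀ η, x η ∈ T) :
    ∑ η : C → Bool, (∑ j, sg (η (ρ j)) * (a j ⬝ᵥ x η) ^ 2) ^ (2 * r) ≤
      2 ^ Fintype.card C * (36 * 10 ^ 9 * r ^ 4 * (S ^ 2 * K ^ 2 * R2)) ^ r := by
  classical
  have hr' : (1 : ℝ) ≤ r := by exact_mod_cast hr
  choose A π hA hπ hπ0 using aux_net a K S r hK hS ha T h0 hT hr hJ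
  set Z : (C → Bool) → (ι → ℝ) → ℝ := fun η x => ∑ j, sg (η (ρ j)) * (a j ⬝ᵥ x) ^ 2 with hZ
  set E : ℝ := 10 ^ 9 * r ^ 2 * (S ^ 2 * K ^ 2 * R2) with hE
  have hE0 : 0 < E := by positivity
  set ε : ℕ → ℝ := fun k => 4 * S * K * Real.sqrt (6 * r / 2 ^ k) with hεd
  have hε2 : ∀ k, ε k ^ 2 = 96 * r * (S ^ 2 * K ^ 2) / 2 ^ k := by
    intro k
    simp only [hεd]
    rw [mul_pow, Real.sq_sqrt (by positivity)]; ring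
  have hεm : ∀ k, ε (k + 1) ≤ ε k := by
    intro k
    simp only [hεd]
    gcongr
    · norm_num
    · omega
  let u : ℕ → (C → Bool) → ℝ := fun k η =>
    if k < 5 * r then Z η (π (k + 1) (x η)) - Z η (π k (x η)) else Z η (x η) - Z η (π (5 * r) (x η))
  have hZ0 : ∀ η, Z η (π 0 (x η)) = 0 := by
    intro η; rw [hπ0 0 rfl]; simp [hZ]
  have htel : ∀ η, Z η (x η) = ∑ k ∈ Finset.range (5 * r + 1), u k η := by
    intro η
    rw [Finset.sum_range_succ]
    have : ∑ k ∈ Finset.range (5 * r), u k η =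
        ∑ k ∈ Finset.range (5 * r), (Z η (π (k + 1) (x η)) - Z η (π k (x η))) :=
      Finset.sum_congr rfl fun k hk => by simp only [u]; rw [if_pos (Finset.mem_range.mp hk)]
    rw [this, Finset.sum_range_sub (fun k => Z η (π k (x η))), hZ0]
    simp [u]
  have hlev : ∀ k ∈ Finset.range (5 * r + 1),
      ∑ η : C → Bool, u k η ^ (2 * r) ≤ 2 ^ Fintype.card C * E ^ r := by
    intro k hk
    by_cases hk4 : k < 5 * r
    · set v : (ι → ℝ) × (ι → ℝ) → C → ℝ := fun b c =>
        ∑ j ∈ Finset.univ.filter (fun j => ρ j = c), ((a j ⬝ᵥ b.1) ^ 2 - (a j ⬝ᵥ b.2) ^ 2) with hv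
      set D : ℝ := 16 * (2 * ε k) ^ 2 * R2 with hD
      have hεpos : 0 < ε k := by simp only [hεd]; positivity
      have hDpos : 0 < D := by positivity
      set P := (A (k + 1) ×ˢ A k).filter (fun b => ∑ c, v b c ^ 2 ≤ D) with hP
      have hu : ∀ η, u k η = ∑ c, sg (η c) * v (π (k + 1) (x η), π k (x η)) c := by
        intro η
        change (if k < 5 * r then _ else _) = _
        rw [if_pos hk4]
        exact aux_Z_sub a ρ η _ _
      have hl := aux_level P v D (Real.exp (9 * r)) r (2 ^ k) hr Nat.one_le_two_pow hDpos
        (Real.exp_pos _).le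
        (by
          have hc : (P.card : ℝ) ≤ (A (k + 1)).card * (A k).card := by
            rw [← Nat.cast_mul, ← Finset.card_product]
            exact_mod_cast Finset.card_filter_le _ _
          refine hc.trans ?_
          have h1 : ∀ k, ((A k).card : ℝ) ≤ Real.exp (3 * r) ^ 2 ^ k := by
            intro k
            calc ((A k).card : ℝ) ≤ ((2 * Fintype.card ι + 1 : ℕ) : ℝ) ^ 2 ^ k := by
                  exact_mod_cast hA k
              _ ≤ _ := by push_cast; gcongr
          calc ((A (k + 1)).card : ℝ) * (A k).card
              ≤ Real.exp (3 * r) ^ 2 ^ (k + 1) * Real.exp (3 * r) ^ 2 ^ k :=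
                mul_le_mul (h1 _) (h1 _) (Nat.cast_nonneg _) (by positivity)
            _ = (Real.exp (3 * r) ^ 3) ^ 2 ^ k := by
                rw [← pow_add, ← pow_mul, pow_succ 2 k]
                exact congrArg (fun t : ℕ => Real.exp (3 * r) ^ t) (by omega)
            _ = Real.exp (9 * r) ^ 2 ^ k := by
                congr 1; rw [← Real.exp_nat_mul]; congr 1; push_cast; ring)
        (fun b hb => (Finset.mem_filter.mp hb).2)
        (fun η => (π (k + 1) (x η), π k (x η)))
        (by
          intro η
          obtain ⟨h1, h2, h3⟩ := hπ (k + 1) (x η) (hx η)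
          obtain ⟨h4, h5, h6⟩ := hπ k (x η) (hx η)
          rw [hP, Finset.mem_filter, Finset.mem_product]
          refine ⟨⟨h1, h4⟩, ?_⟩
          refine aux_incr a ρ hρ R2 (2 * ε k) _ _ (hTR _ h2) (hTR _ h5) ?_
          intro j
          have e : π (k + 1) (x η) - π k (x η) = (x η - π k (x η)) - (x η - π (k + 1) (x η)) := by
            abel
          rw [e, dotProduct_sub]
          refine (abs_sub _ _).trans ?_
          have i1 := h3 j
          have i2 := h6 j
          have i3 := hεm k
          simp only [hεd] at i3 ⊢
          linarith)
      simp only [hu]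
      refine hl.trans ?_
      refine mul_le_mul_of_nonneg_left ?_ (by positivity)
      have e : 16 * (r : ℝ) * (2 ^ k : ℕ) * D = 98304 * r ^ 2 * (S ^ 2 * K ^ 2 * R2) := by
        rw [hD, mul_pow, hε2]; push_cast; field_simp; ring
      rw [e]
      calc Real.exp (9 * r) * (98304 * r ^ 2 * (S ^ 2 * K ^ 2 * R2)) ^ r
          ≤ (10 ^ 4) ^ r * (98304 * r ^ 2 * (S ^ 2 * K ^ 2 * R2)) ^ r := by
            gcongr; exact aux_exp9 r
        _ = (10 ^ 4 * (98304 * r ^ 2 * (S ^ 2 * K ^ 2 * R2))) ^ r := (mul_pow _ _ _).symm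
        _ ≤ E ^ r := by
            have : 0 < (r : ℝ) ^ 2 * (S ^ 2 * K ^ 2 * R2) := by positivity
            apply pow_le_pow_left₀ (by positivity)
            rw [hE]; nlinarith
    · have hs : ∀ η, u k η ^ (2 * r) ≤ E ^ r := by
        intro η
        simp only [u, if_neg hk4]
        obtain ⟨h1, h2, h3⟩ := hπ (5 * r) (x η) (hx η)
        rw [pow_mul]
        refine pow_le_pow_left₀ (sq_nonneg _) ?_ r
        refine (aux_rem a ρ η R2 (ε (5 * r)) _ _ (hTR _ (hx η)) (hTR _ h2) h3).trans ?_
        rw [hε2]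
        have hJ2 : (Fintype.card J : ℝ) ≤ 2 ^ (5 * r) := by
          have e1 : Real.exp (3 * r) = (Real.exp 1 ^ 3) ^ r := by
            rw [← Real.exp_nat_mul, ← Real.exp_nat_mul]; congr 1; push_cast; ring
          have e2 : Real.exp 1 ≤ 2.72 := by linarith [Real.exp_one_lt_d9]
          have e3 : Real.exp 1 ^ 3 ≤ 32 := by
            calc Real.exp 1 ^ 3 ≤ 2.72 ^ 3 := by gcongr
              _ ≤ 32 := by norm_num
          have e5 : (Real.exp 1 ^ 3) ^ r ≤ 2 ^ (5 * r) := by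
            rw [pow_mul]
            calc (Real.exp 1 ^ 3) ^ r ≤ 32 ^ r := by gcongr
              _ = _ := by norm_num
          have e6 : (0 : ℝ) ≤ Fintype.card J := by positivity
          linarith
        have hp : (0 : ℝ) < 2 ^ (5 * r) := by positivity
        calc (Fintype.card J : ℝ) * (4 * (96 * r * (S ^ 2 * K ^ 2) / 2 ^ (5 * r)) * R2)
            ≤ 2 ^ (5 * r) * (4 * (96 * r * (S ^ 2 * K ^ 2) / 2 ^ (5 * r)) * R2) := by gcongr
          _ = 384 * r * (S ^ 2 * K ^ 2 * R2) := by field_simp; ring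
          _ ≤ 10 ^ 9 * r ^ 2 * (S ^ 2 * K ^ 2 * R2) := by
              gcongr ?_ * _
              nlinarith
      calc ∑ η : C → Bool, u k η ^ (2 * r) ≤ ∑ η : C → Bool, E ^ r :=
            Finset.sum_le_sum fun η _ => hs η
        _ = _ := by simp
  calc ∑ η : C → Bool, (Z η (x η)) ^ (2 * r)
      ≤ ∑ η : C → Bool, ((5 * r + 1 : ℕ) : ℝ) ^ (2 * r - 1) *
          ∑ k ∈ Finset.range (5 * r + 1), u k η ^ (2 * r) := by
        refine Finset.sum_le_sum fun η _ => ?_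
        rw [htel η]
        have h1 := aux_pow_sum_le (Finset.range (5 * r + 1)) (fun k => |u k η|)
          (fun _ _ => abs_nonneg _) (2 * r) (by omega)
        simp only [(even_two_mul r).pow_abs, Finset.card_range] at h1
        refine le_trans ?_ h1
        rw [← (even_two_mul r).pow_abs]
        exact pow_le_pow_left₀ (abs_nonneg _) (Finset.abs_sum_le_sum_abs _ _) _
    _ = ((5 * r + 1 : ℕ) : ℝ) ^ (2 * r - 1) *
          ∑ k ∈ Finset.range (5 * r + 1), ∑ η : C → Bool, u k η ^ (2 * r) := by
        rw [← Finset.mul_sum, Finset.sum_comm]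
    _ ≤ ((5 * r + 1 : ℕ) : ℝ) ^ (2 * r - 1) *
          ∑ k ∈ Finset.range (5 * r + 1), 2 ^ Fintype.card C * E ^ r := by
        gcongr with k hk; exact hlev k hk
    _ = ((5 * r + 1 : ℕ) : ℝ) ^ (2 * r - 1 + 1) * (2 ^ Fintype.card C * E ^ r) := by
        rw [Finset.sum_const, Finset.card_range, nsmul_eq_mul, pow_succ]; ring
    _ = 2 ^ Fintype.card C * ((((5 * r + 1 : ℕ) : ℝ)) ^ (2 * r) * E ^ r) := by
        rw [Nat.sub_add_cancel (by omega)]; ring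
    _ ≤ 2 ^ Fintype.card C * ((6 * r) ^ (2 * r) * E ^ r) := by
        gcongr; push_cast; linarith
    _ = 2 ^ Fintype.card C * (36 * 10 ^ 9 * r ^ 4 * (S ^ 2 * K ^ 2 * R2)) ^ r := by
        rw [pow_mul, ← mul_pow, hE]; congr 2; ring

open MeasureTheory ProbabilityTheory Matrix

/-! ### Circulant sign matrices -/

set_option linter.unusedSectionVars false
set_option linter.unusedSimpArgs false

section Circ
variable {m : ℕ} [NeZero m]

/-- Representative of the class `{ω, -ω}`. -/
def repZ (ω : ZMod m) : ZMod m := if ω.val ≤ (-ω).val then ω else -ω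

lemma repZ_neg (ω : ZMod m) : repZ (-ω) = repZ ω := by
  unfold repZ
  rw [neg_neg]
  rcases lt_trichotomy ω.val (-ω).val with h | h | h
  · rw [if_neg (by omega), if_pos (by omega)]
  · rw [if_pos (by omega), if_pos (by omega)]
    exact (ZMod.val_injective m h).symm
  · rw [if_pos (by omega), if_neg (by omega)]

lemma repZ_fiber (c ω : ZMod m) (h : repZ ω = c) : ω = c ∨ ω = -c := by
  unfold repZ at h
  split_ifs at h
  · exact Or.inl h
  · exact Or.inr (by rw [← h, neg_neg])

lemma repZ_card (c : ZMod m) :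
    (Finset.univ.filter fun j : ZMod m × Bool => repZ j.1 = c).card ≤ 4 := by
  have : (Finset.univ.filter fun j : ZMod m × Bool => repZ j.1 = c) ⊆
      ({c, -c} : Finset (ZMod m)) ×ˢ (Finset.univ : Finset Bool) := by
    intro j hj
    have := repZ_fiber c j.1 (Finset.mem_filter.mp hj).2
    simp [Finset.mem_product, this]
  refine (Finset.card_le_card this).trans ?_
  rw [Finset.card_product]
  have : ({c, -c} : Finset (ZMod m)).card ≤ 2 := Finset.card_le_two
  simp; omega

/-- trigonometric functionals -/
noncomputable def trig (j : ZMod m × Bool) (t : ZMod m) : ℝ :=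
  if j.2 then (ZMod.stdAddChar (j.1 * t)).re else (ZMod.stdAddChar (j.1 * t)).im

lemma trig_abs (j : ZMod m × Bool) (t : ZMod m) : |trig j t| ≤ 1 := by
  have h : ‖ZMod.stdAddChar (j.1 * t)‖ = 1 := by simp
  unfold trig
  split_ifs
  · exact (Complex.abs_re_le_norm _).trans h.le
  · exact (Complex.abs_im_le_norm _).trans h.le

/-- circulant kernel -/
noncomputable def gk (η : ZMod m → Bool) (t : ZMod m) : ℝ :=
  (m : ℝ)⁻¹ * ∑ ω : ZMod m, sg (η (repZ ω)) * (ZMod.stdAddChar (ω * t)).re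

lemma gk_complex (η : ZMod m → Bool) (t : ZMod m) :
    ((gk η t : ℝ) : ℂ) = (m : ℂ)⁻¹ * ∑ ω : ZMod m, (sg (η (repZ ω)) : ℂ) * ZMod.stdAddChar (ω * t) := by
  have him : (∑ ω : ZMod m, (sg (η (repZ ω)) : ℂ) * ZMod.stdAddChar (ω * t)).im = 0 := by
    set A := ∑ ω : ZMod m, (sg (η (repZ ω)) : ℂ) * ZMod.stdAddChar (ω * t) with hA
    have : A = (starRingEnd ℂ) A := by
      rw [hA, map_sum, ← Equiv.sum_comp (Equiv.neg (ZMod m))]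
      refine Finset.sum_congr rfl fun ω _ => ?_
      rw [map_mul (starRingEnd ℂ), Complex.conj_ofReal, Equiv.neg_apply, repZ_neg, neg_mul, AddChar.map_neg_eq_conj]
    exact Complex.conj_eq_iff_im.mp this.symm
  apply Complex.ext
  · have : ((m : ℂ)⁻¹) = (((m : ℝ)⁻¹ : ℝ) : ℂ) := by push_cast; rfl
    rw [this, Complex.re_ofReal_mul, Complex.ofReal_re, Complex.re_sum, gk]
    congr 1
    refine Finset.sum_congr rfl fun ω _ => ?_
    rw [Complex.re_ofReal_mul]
  · have : ((m : ℂ)⁻¹) = (((m : ℝ)⁻¹ : ℝ) : ℂ) := by push_cast; rfl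
    rw [this, Complex.im_ofReal_mul, him, Complex.ofReal_im, mul_zero]

lemma char_sum (t : ZMod m) : ∑ i : ZMod m, (ZMod.stdAddChar (i * t) : ℂ) = if t = 0 then (m : ℂ) else 0 := by
  rw [AddChar.sum_mulShift t (ZMod.isPrimitive_stdAddChar m)]
  simp [ZMod.card]

lemma sg_sq (b : Bool) : sg b * sg b = 1 := by cases b <;> simp [sg]

lemma gk_conv (η : ZMod m → Bool) (t t' : ZMod m) :
    ∑ u : ZMod m, gk η (t - u) * gk η (u - t') = if t = t' then 1 else 0 := by
  have hm : (m : ℂ) ≠ 0 := by exact_mod_cast NeZero.ne m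
  have h : ((∑ u : ZMod m, gk η (t - u) * gk η (u - t') : ℝ) : ℂ) = if t = t' then 1 else 0 := by
    push_cast
    simp_rw [gk_complex]
    have : ∀ u : ZMod m, ((m : ℂ)⁻¹ * ∑ ω : ZMod m, (sg (η (repZ ω)) : ℂ) * ZMod.stdAddChar (ω * (t - u))) *
       ((m : ℂ)⁻¹ * ∑ ω : ZMod m, (sg (η (repZ ω)) : ℂ) * ZMod.stdAddChar (ω * (u - t'))) =
       ∑ ω : ZMod m, ∑ ω' : ZMod m, (m : ℂ)⁻¹ ^ 2 * ((sg (η (repZ ω)) : ℂ) * (sg (η (repZ ω')) : ℂ) *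
         ZMod.stdAddChar (ω * t - ω' * t')) * ZMod.stdAddChar (u * (ω' - ω)) := by
      intro u
      rw [mul_mul_mul_comm, Finset.sum_mul_sum, Finset.mul_sum]
      refine Finset.sum_congr rfl fun ω _ => ?_
      rw [Finset.mul_sum]
      refine Finset.sum_congr rfl fun ω' _ => ?_
      have e : (ZMod.stdAddChar (ω * (t - u)) : ℂ) * ZMod.stdAddChar (ω' * (u - t')) =
          ZMod.stdAddChar (ω * t - ω' * t') * ZMod.stdAddChar (u * (ω' - ω)) := by
        rw [← AddChar.map_add_eq_mul, ← AddChar.map_add_eq_mul]; congr 1; ring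
      linear_combination (m : ℂ)⁻¹ ^ 2 * ((sg (η (repZ ω)) : ℂ) * (sg (η (repZ ω')) : ℂ)) * e
    simp_rw [this]
    rw [Finset.sum_comm]
    have : ∀ ω : ZMod m, ∑ u : ZMod m, ∑ ω' : ZMod m, (m : ℂ)⁻¹ ^ 2 * ((sg (η (repZ ω)) : ℂ) * (sg (η (repZ ω')) : ℂ) *
         ZMod.stdAddChar (ω * t - ω' * t')) * ZMod.stdAddChar (u * (ω' - ω)) =
         (m : ℂ)⁻¹ * ZMod.stdAddChar (ω * (t - t')) := by
      intro ω
      rw [Finset.sum_comm]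
      simp_rw [← Finset.mul_sum, char_sum, sub_eq_zero]
      rw [Finset.sum_eq_single ω]
      · rw [if_pos rfl]
        have := sg_sq (η (repZ ω))
        have h2 : (sg (η (repZ ω)) : ℂ) * sg (η (repZ ω)) = 1 := by exact_mod_cast this
        rw [h2, ← mul_sub]; field_simp
      · intro b _ hb; rw [if_neg hb, mul_zero]
      · simp
    simp_rw [this]
    rw [← Finset.mul_sum, char_sum]
    simp only [sub_eq_zero]
    split_ifs <;> simp [hm]
  have h2 : ((if t = t' then (1 : ℝ) else 0 : ℝ) : ℂ) = if t = t' then 1 else 0 := by split_ifs <;> simp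
  rw [← h2] at h
  exact_mod_cast h

lemma gk_trig (η : ZMod m → Bool) (t t' : ZMod m) :
    gk η (t - t') = (m : ℝ)⁻¹ * ∑ j : ZMod m × Bool, sg (η (repZ j.1)) * (trig j t * trig j t') := by
  unfold gk
  rw [Fintype.sum_prod_type]
  congr 1
  refine Finset.sum_congr rfl fun ω _ => ?_
  simp only [Fintype.sum_bool, trig]
  rw [mul_sub, AddChar.map_sub_eq_div, div_eq_mul_inv, ← AddChar.map_neg_eq_inv,
    AddChar.map_neg_eq_conj]
  simp [Complex.mul_re]; ring

lemma gk_true (t : ZMod m) : gk (fun _ => true) t = if t = 0 then 1 else 0 := by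
  have h := gk_complex (fun _ => true) t
  simp only [sg, if_true, Complex.ofReal_one, one_mul, char_sum] at h
  have hm : (m : ℂ) ≠ 0 := by exact_mod_cast NeZero.ne m
  split_ifs at h ⊢
  · rw [inv_mul_cancel₀ hm] at h; exact_mod_cast h
  · rw [mul_zero] at h; exact_mod_cast h

lemma gk_neg (η : ZMod m → Bool) (t : ZMod m) : gk η (-t) = gk η t := by
  unfold gk
  congr 1
  refine Finset.sum_congr rfl fun ω _ => ?_
  rw [mul_neg, AddChar.map_neg_eq_conj, Complex.conj_re]

/-- `Fin m` into `ZMod m`. -/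
def fz (j : Fin m) : ZMod m := ((j : ℕ) : ZMod m)

lemma fz_bij : Function.Bijective (fz : Fin m → ZMod m) := by
  rw [Fintype.bijective_iff_injective_and_card]
  refine ⟨fun a b h => ?_, by simp [ZMod.card]⟩
  have := congrArg ZMod.val h
  unfold fz at this
  rw [ZMod.val_natCast_of_lt a.2, ZMod.val_natCast_of_lt b.2] at this
  exact Fin.ext this

/-- cyclic shift -/
def shf (k : ℕ) (j : Fin m) : Fin m := ⟨(k + (j : ℕ)) % m, Nat.mod_lt _ j.pos⟩

lemma fz_shf (k : ℕ) (j : Fin m) : fz (shf k j) = (k : ZMod m) + fz j := by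
  unfold fz shf
  simp

lemma shf_bij (k : ℕ) : Function.Bijective (shf k : Fin m → Fin m) := by
  rw [← Finite.injective_iff_bijective]
  intro a b h
  have := congrArg fz h
  rw [fz_shf, fz_shf] at this
  exact fz_bij.1 (add_left_cancel this)

/-- the circulant sign matrix -/
noncomputable def GM (η : ZMod m → Bool) (j j' : Fin m) : ℝ := gk η (fz j - fz j')

lemma GM_symm (η : ZMod m → Bool) (j j' : Fin m) : GM η j j' = GM η j' j := by
  unfold GM; rw [← gk_neg, neg_sub]

lemma GM_shf (η : ZMod m → Bool) (k : ℕ) (j j' : Fin m) : GM η (shf k j) (shf k j') = GM η j j' := by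
  unfold GM; rw [fz_shf, fz_shf, add_sub_add_left_eq_sub]

lemma GM_sq (η : ZMod m → Bool) (j j' : Fin m) :
    ∑ u, GM η j u * GM η u j' = if j = j' then 1 else 0 := by
  unfold GM
  rw [fz_bij.sum_comp (fun u => gk η (fz j - u) * gk η (u - fz j')), gk_conv]
  simp [fz_bij.1.eq_iff]

lemma GM_apply_sq (η : ZMod m → Bool) (v : Fin m → ℝ) :
    ∑ j, (∑ j', GM η j j' * v j') ^ 2 = ∑ j, v j ^ 2 := by
  calc ∑ j, (∑ j', GM η j j' * v j') ^ 2
      = ∑ j, ∑ a, ∑ b, (v a * v b) * (GM η a j * GM η j b) := by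
        refine Finset.sum_congr rfl fun j _ => ?_
        rw [sq, Finset.sum_mul_sum]
        refine Finset.sum_congr rfl fun a _ => Finset.sum_congr rfl fun b _ => ?_
        rw [GM_symm η a j]; ring
    _ = ∑ a, ∑ b, (v a * v b) * ∑ j, (GM η a j * GM η j b) := by
        rw [Finset.sum_comm]
        refine Finset.sum_congr rfl fun a _ => ?_
        rw [Finset.sum_comm]
        refine Finset.sum_congr rfl fun b _ => ?_
        rw [Finset.mul_sum]
    _ = _ := by
        simp_rw [GM_sq]
        simp [sq]

lemma GM_quad (η : ZMod m → Bool) (v : Fin m → ℝ) :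
    ∑ j, v j * (∑ j', GM η j j' * v j') =
      (m : ℝ)⁻¹ * ∑ j : ZMod m × Bool, sg (η (repZ j.1)) * (∑ t, trig j (fz t) * v t) ^ 2 := by
  unfold GM
  simp_rw [gk_trig]
  calc _ = ∑ t, ∑ t', ∑ j : ZMod m × Bool, (m : ℝ)⁻¹ * (sg (η (repZ j.1)) *
            ((trig j (fz t) * v t) * (trig j (fz t') * v t'))) := by
        refine Finset.sum_congr rfl fun t _ => ?_
        rw [Finset.mul_sum]
        refine Finset.sum_congr rfl fun t' _ => ?_
        rw [Finset.mul_sum, Finset.sum_mul, Finset.mul_sum]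
        refine Finset.sum_congr rfl fun j _ => ?_
        ring
    _ = ∑ j : ZMod m × Bool, ∑ t, ∑ t', (m : ℝ)⁻¹ * (sg (η (repZ j.1)) *
            ((trig j (fz t) * v t) * (trig j (fz t') * v t'))) := by
        rw [Finset.sum_comm]
        refine Eq.trans ?_ Finset.sum_comm
        rw [Finset.sum_comm]
        exact Finset.sum_congr rfl fun t _ => Finset.sum_comm
    _ = _ := by
        rw [Finset.mul_sum]
        simp_rw [sq, Finset.sum_mul_sum, Finset.mul_sum]

lemma trig_parseval (v : Fin m → ℝ) :
    ∑ j : ZMod m × Bool, (∑ t, trig j (fz t) * v t) ^ 2 = m * ∑ t, v t ^ 2 := by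
  have h := GM_quad (fun _ => true) v
  have h2 : ∀ j j' : Fin m, GM (fun _ => true) j j' = if j = j' then 1 else 0 := by
    intro j j'; unfold GM; rw [gk_true]; simp [sub_eq_zero, fz_bij.1.eq_iff]
  simp only [h2, sg, if_true, one_mul] at h
  have hm : (m : ℝ) ≠ 0 := by exact_mod_cast NeZero.ne m
  simp only [ite_mul, one_mul, zero_mul, Finset.sum_ite_eq, Finset.mem_univ, if_true] at h
  simp_rw [sq]
  rw [h]; field_simp

end Circ

open MeasureTheory ProbabilityTheory Matrix

/-! ### Gaussian invariance -/

set_option linter.unusedSectionVars false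

section Gauss
variable {p m : ℕ} [NeZero m]

instance : IsProbabilityMeasure (gaussMeasure p m) := by
  unfold gaussMeasure; infer_instance

/-- coordinate vector -/
def eit (i : Fin p) (t : Fin m) : Fin p → Fin m → ℝ := Pi.single i (Pi.single t 1)

lemma charFun_gauss (ℓ : StrongDual ℝ (Fin p → Fin m → ℝ)) :
    charFunDual (gaussMeasure p m) ℓ =
      Complex.exp (-(((m : ℝ)⁻¹ / 2 * ∑ i, ∑ t, ℓ (eit i t) ^ 2 : ℝ) : ℂ)) := by
  unfold gaussMeasure
  rw [charFunDual_pi]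
  simp_rw [charFunDual_pi]
  have h : ∀ (i : Fin p) (t : Fin m), charFunDual (gaussianReal 0 ((m : NNReal))⁻¹)
      ((ℓ.comp (.single ℝ _ i)).comp (.single ℝ (fun _ : Fin m => ℝ) t)) =
      Complex.exp (-(((m : ℝ)⁻¹ / 2 * ℓ (eit i t) ^ 2 : ℝ) : ℂ)) := by
    intro i t
    set L := (ℓ.comp (.single ℝ _ i)).comp (.single ℝ (fun _ : Fin m => ℝ) t) with hL
    have hL2 : ∀ x : ℝ, L x = ℓ (eit i t) * x := by
      intro x
      have : L x = L (x • (1 : ℝ)) := by simp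
      rw [this, map_smul, smul_eq_mul, mul_comm]
      rfl
    have e : charFunDual (gaussianReal 0 ((m : NNReal))⁻¹) L =
        charFun (gaussianReal 0 ((m : NNReal))⁻¹) (ℓ (eit i t)) := by
      rw [charFunDual_apply, charFun_apply_real]
      refine integral_congr_ae (Filter.Eventually.of_forall fun x => ?_)
      simp only [hL2]; push_cast; rfl
    rw [e, charFun_gaussianReal]
    congr 1
    push_cast
    ring
  simp_rw [h]
  simp_rw [← Complex.exp_sum]
  congr 1
  push_cast
  simp_rw [Finset.mul_sum, Finset.sum_neg_distrib]

/-- quadratic norm of a functional -/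
noncomputable def Qf (ℓ : (Fin p → Fin m → ℝ) →ₗ[ℝ] ℝ) : ℝ := ∑ i, ∑ t, ℓ (eit i t) ^ 2

lemma map_gauss (ℓ : (Fin p → Fin m → ℝ) →ₗ[ℝ] ℝ) :
    (gaussMeasure p m).map ℓ = gaussianReal 0 ((m : ℝ)⁻¹ * Qf ℓ).toNNReal := by
  set ℓ' : StrongDual ℝ (Fin p → Fin m → ℝ) := LinearMap.toContinuousLinearMap ℓ with hl
  have hc : (ℓ : (Fin p → Fin m → ℝ) → ℝ) = ℓ' := by ext; simp [hl]
  rw [hc]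
  have : IsProbabilityMeasure ((gaussMeasure p m).map ℓ') :=
    Measure.isProbabilityMeasure_map (by fun_prop)
  apply Measure.ext_of_charFun
  ext u
  rw [charFun_map_eq_charFunDual_smul, charFun_gauss, charFun_gaussianReal]
  congr 1
  have hQ : 0 ≤ (m : ℝ)⁻¹ * Qf ℓ := by unfold Qf; positivity
  have : ∑ i, ∑ t, (u • ℓ') (eit i t) ^ 2 = u ^ 2 * Qf ℓ := by
    unfold Qf
    rw [Finset.mul_sum]
    refine Finset.sum_congr rfl fun i _ => ?_
    rw [Finset.mul_sum]
    refine Finset.sum_congr rfl fun t _ => ?_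
    simp [hl]; ring
  rw [this, show ((((m : ℝ)⁻¹ * Qf ℓ).toNNReal : ℝ) : ℂ) = (((m : ℝ)⁻¹ * Qf ℓ : ℝ) : ℂ) by
    rw [Real.coe_toNNReal _ hQ]]
  push_cast
  ring

/-- apply `GM` channelwise -/
noncomputable def Gmap (η : ZMod m → Bool) : (Fin p → Fin m → ℝ) →ₗ[ℝ] (Fin p → Fin m → ℝ) where
  toFun φ := fun i t => ∑ t', GM η t t' * φ i t'
  map_add' φ ψ := by
    ext i t; simp [mul_add, Finset.sum_add_distrib]
  map_smul' c φ := by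
    ext i t; simp [Finset.mul_sum]; exact Finset.sum_congr rfl fun _ _ => by ring

/-- the swap map -/
noncomputable def swp (η : ZMod m → Bool) :
    ((Fin p → Fin m → ℝ) × (Fin p → Fin m → ℝ)) →ₗ[ℝ]
      ((Fin p → Fin m → ℝ) × (Fin p → Fin m → ℝ)) where
  toFun z := ((2 : ℝ)⁻¹ • (z.1 + z.2 + Gmap η (z.1 - z.2)), (2 : ℝ)⁻¹ • (z.1 + z.2 - Gmap η (z.1 - z.2)))
  map_add' z w := by
    ext i t <;> simp only [Prod.fst_add, Prod.snd_add, map_sub, map_add, Pi.add_apply, Pi.sub_apply, Pi.smul_apply, smul_eq_mul] <;> ring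
  map_smul' c z := by
    ext i t <;> simp only [Prod.smul_fst, Prod.smul_snd, map_sub, map_smul, Pi.add_apply, Pi.sub_apply, Pi.smul_apply, smul_eq_mul, RingHom.id_apply] <;> ring

lemma Gmap_eit (η : ZMod m → Bool) (i : Fin p) (t : Fin m) :
    Gmap η (eit i t) = ∑ t', GM η t t' • eit i t' := by
  ext i' u
  simp only [Gmap, LinearMap.coe_mk, AddHom.coe_mk, Finset.sum_apply, Pi.smul_apply, smul_eq_mul]
  by_cases h : i' = i
  · subst h
    simp [eit, Pi.single_apply, GM_symm η u t]
  · simp [eit, Pi.single_apply, h]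

lemma swp_preserves (η : ZMod m → Bool) :
    ((gaussMeasure p m).prod (gaussMeasure p m)).map (swp η) =
      (gaussMeasure p m).prod (gaussMeasure p m) := by
  set T := LinearMap.toContinuousLinearMap (swp (p := p) η) with hT
  have hc : (swp (p := p) η : _ → _) = T := by ext <;> simp [hT]
  rw [hc]
  have : IsProbabilityMeasure (((gaussMeasure p m).prod (gaussMeasure p m)).map T) :=
    Measure.isProbabilityMeasure_map (by fun_prop)
  apply Measure.ext_of_charFunDual
  ext ℓ
  rw [charFunDual_map, charFunDual_prod, charFunDual_prod, charFun_gauss, charFun_gauss,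
    charFun_gauss, charFun_gauss, ← Complex.exp_add, ← Complex.exp_add]
  congr 1
  rw [← neg_add, ← neg_add, ← Complex.ofReal_add, ← Complex.ofReal_add, ← mul_add, ← mul_add]
  congr 3
  simp_rw [← Finset.sum_add_distrib]
  refine Finset.sum_congr rfl fun i _ => ?_
  set α : Fin m → ℝ := fun t => ℓ (eit i t, 0) with hα
  set β : Fin m → ℝ := fun t => ℓ (0, eit i t) with hβ
  have hpair : ∀ a b : Fin p → Fin m → ℝ, ℓ (a, b) = ℓ (a, 0) + ℓ (0, b) := by
    intro a b; rw [← map_add]; simp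
  have hinl : ∀ v : Fin p → Fin m → ℝ, ℓ (v, 0) = ℓ.comp (.inl ℝ _ _) v := fun v => rfl
  have hinr : ∀ v : Fin p → Fin m → ℝ, ℓ (0, v) = ℓ.comp (.inr ℝ _ _) v := fun v => rfl
  have hGl : ∀ t, ℓ (Gmap η (eit i t), 0) = ∑ t', GM η t t' * α t' := by
    intro t; rw [hinl, Gmap_eit, map_sum]; simp [hα]
  have hGr : ∀ t, ℓ (0, Gmap η (eit i t)) = ∑ t', GM η t t' * β t' := by
    intro t; rw [hinr, Gmap_eit, map_sum]; simp [hβ]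
  have h1 : ∀ t, (ℓ.comp T).comp (.inl ℝ _ _) (eit i t) =
      2⁻¹ * (α t + β t + ∑ t', GM η t t' * (α t' - β t')) := by
    intro t
    have : (ℓ.comp T).comp (.inl ℝ _ _) (eit i t) =
      ℓ ((2 : ℝ)⁻¹ • (eit i t + Gmap η (eit i t)), (2 : ℝ)⁻¹ • (eit i t - Gmap η (eit i t))) := by
      simp [hT, swp]
    rw [this, hpair, hinl, hinr, map_smul, map_smul, map_add, map_sub, ← hinl, ← hinl, ← hinr, ← hinr,
      hGl, hGr]
    simp only [mul_sub, Finset.sum_sub_distrib, smul_eq_mul, hα, hβ]; ring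
  have h2 : ∀ t, (ℓ.comp T).comp (.inr ℝ _ _) (eit i t) =
      2⁻¹ * (α t + β t - ∑ t', GM η t t' * (α t' - β t')) := by
    intro t
    have : (ℓ.comp T).comp (.inr ℝ _ _) (eit i t) =
      ℓ ((2 : ℝ)⁻¹ • (eit i t - Gmap η (eit i t)), (2 : ℝ)⁻¹ • (eit i t + Gmap η (eit i t))) := by
      simp [hT, swp, smul_sub, sub_eq_add_neg]
    rw [this, hpair, hinl, hinr, map_smul, map_smul, map_add, map_sub, ← hinl, ← hinl, ← hinr, ← hinr,
      hGl, hGr]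
    simp only [mul_sub, Finset.sum_sub_distrib, smul_eq_mul, hα, hβ]; ring
  simp_rw [h1, h2]
  have h3 := GM_apply_sq η (fun t => α t - β t)
  have h4 : ∀ t, ((ℓ.comp (.inl ℝ _ _)) (eit i t)) ^ 2 + ((ℓ.comp (.inr ℝ _ _)) (eit i t)) ^ 2 =
    2⁻¹ * (α t + β t) ^ 2 + 2⁻¹ * (α t - β t) ^ 2 := by
    intro t; rw [← hinl, ← hinr]; simp only [hα, hβ]; ring
  simp_rw [h4, Finset.sum_add_distrib, ← Finset.mul_sum]
  rw [← h3, Finset.mul_sum, Finset.mul_sum, ← Finset.sum_add_distrib, ← Finset.sum_add_distrib]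
  refine Finset.sum_congr rfl fun t _ => ?_
  ring

end Gauss

open MeasureTheory ProbabilityTheory Matrix

/-! ### Action of the probe matrix -/

set_option linter.unusedSectionVars false
section Act
variable {p n m : ℕ} [NeZero m]

/-- action -/
noncomputable def act (p n m : ℕ) (φ : Fin p → Fin m → ℝ) (x : Fin p × Fin n → ℝ) (j : Fin m) : ℝ :=
  ∑ ik : Fin p × Fin n, x ik * φ ik.1 (shf (n - 1 - (ik.2 : ℕ)) j)

/-- squared norm -/
noncomputable def nrm (p n m : ℕ) (φ : Fin p → Fin m → ℝ) (x : Fin p × Fin n → ℝ) : ℝ :=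
  ∑ j, act p n m φ x j ^ 2

/-- frequency coefficients -/
noncomputable def aco (p n m : ℕ) [NeZero m] (φ : Fin p → Fin m → ℝ) (j : ZMod m × Bool)
    (ik : Fin p × Fin n) : ℝ :=
  ∑ t, trig j (fz t) * φ ik.1 (shf (n - 1 - (ik.2 : ℕ)) t)

/-- signed quadratic form -/
noncomputable def quad (p n m : ℕ) [NeZero m] (η : ZMod m → Bool) (φ : Fin p → Fin m → ℝ)
    (x : Fin p × Fin n → ℝ) : ℝ :=
  (m : ℝ)⁻¹ * ∑ j : ZMod m × Bool, sg (η (repZ j.1)) * (aco p n m φ j ⬝ᵥ x) ^ 2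

lemma act_eq (φ : Fin p → Fin m → ℝ) (x : Fin p × Fin n → ℝ) :
    probeMatrix p n m φ *ᵥ x = act p n m φ x := by
  ext j
  simp only [act, probeMatrix, mulVec, dotProduct, shf, of_apply]
  exact Finset.sum_congr rfl fun _ _ => mul_comm _ _

lemma aco_dot (φ : Fin p → Fin m → ℝ) (j : ZMod m × Bool) (x : Fin p × Fin n → ℝ) :
    aco p n m φ j ⬝ᵥ x = ∑ t, trig j (fz t) * act p n m φ x t := by
  unfold aco act dotProduct
  simp_rw [Finset.sum_mul, Finset.mul_sum]
  rw [Finset.sum_comm]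
  refine Finset.sum_congr rfl fun _ _ => Finset.sum_congr rfl fun _ _ => ?_
  ring

lemma aco_parseval (φ : Fin p → Fin m → ℝ) (x : Fin p × Fin n → ℝ) :
    ∑ j, (aco p n m φ j ⬝ᵥ x) ^ 2 = m * nrm p n m φ x := by
  simp_rw [aco_dot]
  exact trig_parseval _

lemma quad_eq (η : ZMod m → Bool) (φ : Fin p → Fin m → ℝ) (x : Fin p × Fin n → ℝ) :
    quad p n m η φ x = ∑ j, act p n m φ x j * ∑ j', GM η j j' * act p n m φ x j' := by
  rw [GM_quad]; unfold quad; simp_rw [aco_dot]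

lemma act_add (φ ψ : Fin p → Fin m → ℝ) (x : Fin p × Fin n → ℝ) (j : Fin m) :
    act p n m (φ + ψ) x j = act p n m φ x j + act p n m ψ x j := by
  simp [act, mul_add, Finset.sum_add_distrib]

lemma act_sub (φ ψ : Fin p → Fin m → ℝ) (x : Fin p × Fin n → ℝ) (j : Fin m) :
    act p n m (φ - ψ) x j = act p n m φ x j - act p n m ψ x j := by
  simp [act, mul_sub, Finset.sum_sub_distrib]

lemma act_smul (c : ℝ) (φ : Fin p → Fin m → ℝ) (x : Fin p × Fin n → ℝ) (j : Fin m) :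
    act p n m (c • φ) x j = c * act p n m φ x j := by
  simp only [act, Finset.mul_sum, Pi.smul_apply, smul_eq_mul]
  exact Finset.sum_congr rfl fun _ _ => by ring

lemma act_G (η : ZMod m → Bool) (φ : Fin p → Fin m → ℝ) (x : Fin p × Fin n → ℝ) (j : Fin m) :
    act p n m (Gmap η φ) x j = ∑ j', GM η j j' * act p n m φ x j' := by
  simp only [act, Gmap, LinearMap.coe_mk, AddHom.coe_mk]
  simp_rw [Finset.mul_sum]
  rw [Finset.sum_comm]
  rw [Finset.sum_comm]
  have : ∀ ik : Fin p × Fin n, ∑ t', x ik * (GM η (shf (n - 1 - (ik.2 : ℕ)) j) t' * φ ik.1 t') =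
      ∑ j', GM η j j' * (x ik * φ ik.1 (shf (n - 1 - (ik.2 : ℕ)) j')) := by
    intro ik
    rw [← (shf_bij (n - 1 - (ik.2 : ℕ))).sum_comp (fun t' =>
      x ik * (GM η (shf (n - 1 - (ik.2 : ℕ)) j) t' * φ ik.1 t'))]
    refine Finset.sum_congr rfl fun t _ => ?_
    rw [GM_shf]; ring
  simp_rw [this]
  rw [Finset.sum_comm]

lemma swp_diff (η : ZMod m → Bool) (φ ψ : Fin p → Fin m → ℝ) (x : Fin p × Fin n → ℝ) :
    nrm p n m (swp η (φ, ψ)).1 x - nrm p n m (swp η (φ, ψ)).2 x =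
      quad p n m η φ x - quad p n m η ψ x := by
  rw [quad_eq, quad_eq]
  unfold nrm
  simp only [swp, LinearMap.coe_mk, AddHom.coe_mk]
  set u := act p n m φ x with hu
  set w := act p n m ψ x with hw
  have hG : ∀ j, act p n m (Gmap η (φ - ψ)) x j =
      ∑ j', GM η j j' * u j' - ∑ j', GM η j j' * w j' := by
    intro j
    rw [act_G, ← Finset.sum_sub_distrib]
    refine Finset.sum_congr rfl fun _ _ => ?_
    rw [act_sub]; ring
  simp_rw [act_smul, act_add, act_sub (_ + _), act_add, hG]
  rw [← hu, ← hw]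
  have hsym : ∑ j, u j * ∑ j', GM η j j' * w j' = ∑ j, w j * ∑ j', GM η j j' * u j' := by
    simp_rw [Finset.mul_sum]
    rw [Finset.sum_comm]
    refine Finset.sum_congr rfl fun a _ => Finset.sum_congr rfl fun b _ => ?_
    rw [GM_symm η b a]; ring
  have : ∀ j, (2⁻¹ * (u j + w j + (∑ j', GM η j j' * u j' - ∑ j', GM η j j' * w j'))) ^ 2 -
     (2⁻¹ * (u j + w j - (∑ j', GM η j j' * u j' - ∑ j', GM η j j' * w j'))) ^ 2 =
     u j * (∑ j', GM η j j' * u j') - w j * (∑ j', GM η j j' * w j') +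
     (w j * (∑ j', GM η j j' * u j') - u j * (∑ j', GM η j j' * w j')) := by intro j; ring
  rw [← Finset.sum_sub_distrib]
  simp_rw [this]
  rw [Finset.sum_add_distrib, Finset.sum_sub_distrib, Finset.sum_sub_distrib, hsym]
  ring

/-- action as a functional in the probe -/
noncomputable def actL (x : Fin p × Fin n → ℝ) (j : Fin m) : (Fin p → Fin m → ℝ) →ₗ[ℝ] ℝ where
  toFun φ := act p n m φ x j
  map_add' φ ψ := act_add φ ψ x j
  map_smul' c φ := act_smul c φ x j

/-- coefficients as functionals in the probe -/
noncomputable def acoL (j : ZMod m × Bool) (ik : Fin p × Fin n) : (Fin p → Fin m → ℝ) →ₗ[ℝ] ℝ where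
  toFun φ := aco p n m φ j ik
  map_add' φ ψ := by simp [aco, mul_add, Finset.sum_add_distrib]
  map_smul' c φ := by
    simp only [aco, Finset.mul_sum, Pi.smul_apply, smul_eq_mul, RingHom.id_apply]
    exact Finset.sum_congr rfl fun _ _ => by ring

lemma Qf_acoL (j : ZMod m × Bool) (ik : Fin p × Fin n) : Qf (acoL j ik) ≤ m := by
  unfold Qf
  have h : ∀ i (t : Fin m), acoL j ik (eit i t) ^ 2 ≤
      if i = ik.1 then (∑ u, if shf (n - 1 - (ik.2 : ℕ)) u = t then 1 else 0) else (0 : ℝ) := by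
    intro i t
    simp only [acoL, aco, LinearMap.coe_mk, AddHom.coe_mk, eit]
    split_ifs with hi
    · subst hi
      obtain ⟨u0, hu0⟩ := (shf_bij (m := m) (n - 1 - (ik.2 : ℕ))).2 t
      subst hu0
      simp only [Pi.single_eq_same, Pi.single_apply, (shf_bij (m := m) (n - 1 - (ik.2 : ℕ))).1.eq_iff]
      simp only [mul_ite, mul_one, mul_zero, Finset.sum_ite_eq', Finset.mem_univ, if_true]
      have := trig_abs j (fz u0)
      rw [← sq_abs]
      exact pow_le_one₀ (abs_nonneg _) this
    · rw [Pi.single_eq_of_ne (Ne.symm hi)]; simp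
  calc _ ≤ ∑ i, ∑ t : Fin m, if i = ik.1 then (∑ u, if shf (n - 1 - (ik.2 : ℕ)) u = t then 1 else 0) else (0 : ℝ) :=
        Finset.sum_le_sum fun i _ => Finset.sum_le_sum fun t _ => h i t
    _ = ∑ t : Fin m, ∑ u, if shf (n - 1 - (ik.2 : ℕ)) u = t then 1 else (0 : ℝ) := by
        rw [Finset.sum_comm]
        simp
    _ = m := by
        rw [Finset.sum_comm]; simp

lemma Qf_actL (hnm : n ≤ m) (x : Fin p × Fin n → ℝ) (j : Fin m) :
    Qf (actL x j) = ∑ ik, x ik ^ 2 := by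
  unfold Qf
  rw [Fintype.sum_prod_type]
  refine Finset.sum_congr rfl fun i _ => ?_
  have h : ∀ t, actL x j (eit i t) = ∑ k : Fin n, x (i, k) * if shf (n - 1 - (k : ℕ)) j = t then 1 else 0 := by
    intro t
    simp only [actL, act, LinearMap.coe_mk, AddHom.coe_mk, eit]
    rw [Fintype.sum_prod_type, Finset.sum_eq_single i]
    · simp [Pi.single_apply]
    · intro b _ hb
      simp [Pi.single_eq_of_ne hb]
    · simp
  have hinj : ∀ k k' : Fin n, shf (n - 1 - (k : ℕ)) j = shf (n - 1 - (k' : ℕ)) j ↔ k = k' := by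
    intro k k'
    refine ⟨fun hh => ?_, fun hh => by rw [hh]⟩
    have := congrArg fz hh
    rw [fz_shf, fz_shf] at this
    have := congrArg ZMod.val (add_right_cancel this)
    rw [ZMod.val_natCast_of_lt (by omega), ZMod.val_natCast_of_lt (by omega)] at this
    exact Fin.ext (by omega)
  simp_rw [h, sq, Finset.sum_mul_sum]
  rw [Finset.sum_comm]
  refine Finset.sum_congr rfl fun k _ => ?_
  rw [Finset.sum_comm, Finset.sum_eq_single k]
  · simp
  · intro b _ hb
    refine Finset.sum_eq_zero fun t _ => ?_
    by_cases h1 : shf (n - 1 - (k : ℕ)) j = t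
    · rw [if_neg (c := shf (n - 1 - (b : ℕ)) j = t)]
      · simp
      · intro h2; exact hb ((hinj _ _).mp (h2.trans h1.symm))
    · rw [if_neg h1]; simp
  · simp

end Act

open MeasureTheory ProbabilityTheory Matrix

/-! ### Gaussian moments and integrability -/

set_option linter.unusedSectionVars false
section Mom
variable {p n m : ℕ} [NeZero m]

instance : IsGaussian (gaussMeasure p m) := by
  apply isGaussian_of_map_eq_gaussianReal
  intro L
  exact ⟨0, _, map_gauss L.toLinearMap⟩

/-- polynomial growth -/
def PG {E : Type*} [NormedAddCommGroup E] (f : E → ℝ) : Prop :=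
  Continuous f ∧ ∃ (C : ℝ) (k : ℕ), 0 ≤ C ∧ ∀ z, |f z| ≤ C * (1 + ‖z‖) ^ k

section PGs
variable {E : Type*} [NormedAddCommGroup E]

lemma PG.const (c : ℝ) : PG (fun _ : E => c) :=
  ⟨continuous_const, |c|, 0, abs_nonneg _, fun z => by simp⟩

lemma PG.add {f g : E → ℝ} (hf : PG f) (hg : PG g) : PG (fun z => f z + g z) := by
  obtain ⟨h1, C, k, hC, h⟩ := hf
  obtain ⟨h2, D, l, hD, h'⟩ := hg
  refine ⟨h1.add h2, C + D, k + l, by positivity, fun z => (abs_add_le _ _).trans ?_⟩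
  have hz : 1 ≤ 1 + ‖z‖ := by linarith [norm_nonneg z]
  have e1 : (1 + ‖z‖) ^ k ≤ (1 + ‖z‖) ^ (k + l) := pow_le_pow_right₀ hz (by omega)
  have e2 : (1 + ‖z‖) ^ l ≤ (1 + ‖z‖) ^ (k + l) := pow_le_pow_right₀ hz (by omega)
  calc |f z| + |g z| ≤ C * (1 + ‖z‖) ^ k + D * (1 + ‖z‖) ^ l := add_le_add (h z) (h' z)
    _ ≤ C * (1 + ‖z‖) ^ (k + l) + D * (1 + ‖z‖) ^ (k + l) := by gcongr
    _ = _ := by ring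

lemma PG.mul {f g : E → ℝ} (hf : PG f) (hg : PG g) : PG (fun z => f z * g z) := by
  obtain ⟨h1, C, k, hC, h⟩ := hf
  obtain ⟨h2, D, l, hD, h'⟩ := hg
  refine ⟨h1.mul h2, C * D, k + l, by positivity, fun z => ?_⟩
  rw [abs_mul]
  calc |f z| * |g z| ≤ (C * (1 + ‖z‖) ^ k) * (D * (1 + ‖z‖) ^ l) :=
        mul_le_mul (h z) (h' z) (abs_nonneg _) (by positivity)
    _ = _ := by ring

lemma PG.pow {f : E → ℝ} (hf : PG f) (l : ℕ) : PG (fun z => f z ^ l) := by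
  induction l with
  | zero => simpa using PG.const 1
  | succ l ih => simpa only [pow_succ] using ih.mul hf

lemma PG.sub {f g : E → ℝ} (hf : PG f) (hg : PG g) : PG (fun z => f z - g z) := by
  have := hf.add ((PG.const (-1)).mul hg)
  simpa [sub_eq_add_neg] using this

lemma PG.sum {β : Type*} (s : Finset β) {f : β → E → ℝ} (hf : ∀ b ∈ s, PG (f b)) :
    PG (fun z => ∑ b ∈ s, f b z) := by
  classical
  induction s using Finset.induction_on with
  | empty => simpa using PG.const 0
  | insert a s ha ih =>
    simp_rw [Finset.sum_insert ha]
    exact (hf a (by simp)).add (ih fun b hb => hf b (by simp [hb]))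

/-- domination -/
lemma PG.of_le {f g : E → ℝ} (hg : PG g) (hc : Continuous f) (h : ∀ z, |f z| ≤ g z) : PG f := by
  obtain ⟨h1, C, k, hC, h'⟩ := hg
  exact ⟨hc, C, k, hC, fun z => (h z).trans ((le_abs_self _).trans (h' z))⟩

lemma PG.abs {f : E → ℝ} (hf : PG f) : PG (fun z => |f z|) := by
  obtain ⟨h1, C, k, hC, h'⟩ := hf
  exact ⟨h1.abs, C, k, hC, fun z => by simpa using h' z⟩

lemma PG.pinorm {τ : Type*} [Fintype τ] {f : τ → E → ℝ} (hf : ∀ b, PG (f b)) :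
    PG (fun z => ‖fun b => f b z‖) := by
  refine PG.of_le (g := fun z => ∑ b, |f b z|) (PG.sum _ fun b _ => (hf b).abs) ?_ ?_
  · exact continuous_norm.comp (continuous_pi fun b => (hf b).1)
  · intro z
    rw [abs_norm, pi_norm_le_iff_of_nonneg (Finset.sum_nonneg fun _ _ => abs_nonneg _)]
    intro b
    exact Finset.single_le_sum (f := fun b => |f b z|) (fun _ _ => abs_nonneg _) (Finset.mem_univ b)

lemma PG.integrable [NormedSpace ℝ E] [MeasurableSpace E] [BorelSpace E] [CompleteSpace E]
    [SecondCountableTopology E] {μ : Measure E} [IsGaussian μ] {f : E → ℝ} (hf : PG f) :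
    Integrable f μ := by
  obtain ⟨h1, C, k, hC, h'⟩ := hf
  have hm0 : MemLp (fun z : E => z) (k : ENNReal) μ := IsGaussian.memLp_id μ k (by simp)
  have hm1 : MemLp (fun z : E => ‖z‖) (k : ENNReal) μ := hm0.norm
  have hm2 : MemLp (fun _ : E => (1 : ℝ)) (k : ENNReal) μ := memLp_const 1
  have hm : MemLp (fun z : E => 1 + ‖z‖) (k : ENNReal) μ := hm2.add hm1
  have h2 : Integrable (fun z : E => C * (1 + ‖z‖) ^ k) μ := by
    have := hm.integrable_norm_pow'
    refine (this.const_mul C).congr (Filter.Eventually.of_forall fun z => ?_)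
    simp only [Real.norm_of_nonneg (show 0 ≤ 1 + ‖z‖ by positivity)]
  have h3 : AEStronglyMeasurable f μ := h1.aestronglyMeasurable
  refine h2.mono' h3 (Filter.Eventually.of_forall fun z => ?_)
  exact h' z

end PGs

lemma PG.lin {E : Type*} [NormedAddCommGroup E] [NormedSpace ℝ E] [FiniteDimensional ℝ E]
    (ℓ : E →ₗ[ℝ] ℝ) : PG ℓ := by
  refine ⟨ℓ.continuous_of_finiteDimensional, ‖LinearMap.toContinuousLinearMap ℓ‖, 1, norm_nonneg _, ?_⟩
  intro z
  have := (LinearMap.toContinuousLinearMap ℓ).le_opNorm z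
  simp only [LinearMap.coe_toContinuousLinearMap', Real.norm_eq_abs] at this
  refine this.trans ?_
  rw [pow_one]
  gcongr
  linarith

lemma gauss_sq (ℓ : (Fin p → Fin m → ℝ) →ₗ[ℝ] ℝ) :
    ∫ φ, ℓ φ ^ 2 ∂(gaussMeasure p m) = (m : ℝ)⁻¹ * Qf ℓ := by
  have hQ : 0 ≤ (m : ℝ)⁻¹ * Qf ℓ := by unfold Qf; positivity
  have hc : Continuous ℓ := ℓ.continuous_of_finiteDimensional
  have h1 : ∫ φ, ℓ φ ^ 2 ∂(gaussMeasure p m) = ∫ y, y ^ 2 ∂((gaussMeasure p m).map ℓ) := by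
    rw [integral_map hc.measurable.aemeasurable (by fun_prop)]
  rw [h1, map_gauss]
  have h2 := variance_id_gaussianReal (μ := 0) (v := ((m : ℝ)⁻¹ * Qf ℓ).toNNReal)
  rw [variance_eq_integral (by fun_prop)] at h2
  simp only [id, integral_id_gaussianReal, sub_zero] at h2
  rw [h2, Real.coe_toNNReal _ hQ]

lemma gauss_mom (ℓ : (Fin p → Fin m → ℝ) →ₗ[ℝ] ℝ) (hl : Qf ℓ ≤ m) (q : ℕ) (hq : 1 ≤ q) :
    ∫ φ, ℓ φ ^ (2 * q) ∂(gaussMeasure p m) ≤ (16 * q) ^ q := by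
  have hQ : 0 ≤ (m : ℝ)⁻¹ * Qf ℓ := by unfold Qf; positivity
  have hm : (0 : ℝ) < m := by exact_mod_cast NeZero.pos m
  have hQ1 : (m : ℝ)⁻¹ * Qf ℓ ≤ 1 := by rw [inv_mul_le_iff₀ hm]; linarith
  have hc : Continuous ℓ := ℓ.continuous_of_finiteDimensional
  have h1 : ∫ φ, ℓ φ ^ (2 * q) ∂(gaussMeasure p m) = ∫ y, y ^ (2 * q) ∂((gaussMeasure p m).map ℓ) := by
    rw [integral_map hc.measurable.aemeasurable (by fun_prop)]
  rw [h1, map_gauss]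
  set v := ((m : ℝ)⁻¹ * Qf ℓ).toNNReal with hv
  have hv1 : (v : ℝ) ≤ 1 := by rw [hv, Real.coe_toNNReal _ hQ]; exact hQ1
  set c := Real.sqrt (2 * q / 1) with hcd
  have hc2 : c ^ 2 = 2 * q := by rw [hcd, Real.sq_sqrt (by positivity)]; simp
  have i1 := integrable_exp_mul_gaussianReal (μ := 0) (v := v) c
  have i2 := integrable_exp_mul_gaussianReal (μ := 0) (v := v) (-c)
  have e1 : ∀ t : ℝ, ∫ y, Real.exp (t * y) ∂(gaussianReal 0 v) = Real.exp (v * t ^ 2 / 2) := by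
    intro t
    have := mgf_gaussianReal (X := id) (p := gaussianReal 0 v) (μ := 0) (v := v) (by simp) t
    simp only [mgf, id, zero_mul, zero_add] at this
    exact this
  calc ∫ y, y ^ (2 * q) ∂(gaussianReal 0 v)
      ≤ ∫ y, (2 * q * 1) ^ q * (Real.exp (c * y) + Real.exp (-c * y)) ∂(gaussianReal 0 v) := by
        refine integral_mono_of_nonneg (Filter.Eventually.of_forall fun y => ?_)
          ((i1.add i2).const_mul _) (Filter.Eventually.of_forall fun y => ?_)
        · simp only [pow_mul]; positivity
        · have := aux_pow_le_exp y 1 q hq one_pos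
          simp only [neg_mul]; exact this
    _ = (2 * q) ^ q * (2 * Real.exp (v * c ^ 2 / 2)) := by
        rw [integral_const_mul, integral_add i1 i2, e1, e1, neg_sq]; ring
    _ ≤ (2 * q) ^ q * 8 ^ q := by
        gcongr
        refine le_trans ?_ (aux_two_exp_le q hq)
        gcongr
        rw [hc2]
        have : (0 : ℝ) ≤ q := by positivity
        nlinarith
    _ = _ := by rw [← mul_pow]; congr 1; ring

lemma PG_act (x : Fin p × Fin n → ℝ) (j : Fin m) : PG (fun φ => act p n m φ x j) :=
  PG.lin (actL x j)

lemma PG_aco (j : ZMod m × Bool) (ik : Fin p × Fin n) : PG (fun φ => aco p n m φ j ik) :=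
  PG.lin (acoL j ik)

lemma PG_nrm (x : Fin p × Fin n → ℝ) : PG (fun φ : Fin p → Fin m → ℝ => nrm p n m φ x) :=
  PG.sum _ fun j _ => (PG_act x j).pow 2

lemma PG_quad (η : ZMod m → Bool) (x : Fin p × Fin n → ℝ) : PG (fun φ => quad p n m η φ x) := by
  unfold quad
  refine (PG.const _).mul (PG.sum _ fun j _ => (PG.const _).mul (PG.pow ?_ 2))
  exact PG.sum _ fun ik _ => (PG_aco j ik).mul (PG.const _)

lemma nrm_integral (hnm : n ≤ m) (x : Fin p × Fin n → ℝ) :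
    ∫ φ, nrm p n m φ x ∂(gaussMeasure p m) = ∑ ik, x ik ^ 2 := by
  unfold nrm
  rw [integral_finsetSum _ fun j _ => ((PG_act x j).pow 2).integrable]
  have : ∀ j : Fin m, ∫ φ, act p n m φ x j ^ 2 ∂(gaussMeasure p m) = (m : ℝ)⁻¹ * ∑ ik, x ik ^ 2 := by
    intro j
    rw [← Qf_actL hnm x j]
    exact gauss_sq (actL x j)
  simp_rw [this]
  have hm : (m : ℝ) ≠ 0 := by exact_mod_cast NeZero.ne m
  simp; field_simp

/-- the size of the coefficients -/
noncomputable def Kf (p n m : ℕ) [NeZero m] (φ : Fin p → Fin m → ℝ) : ℝ :=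
  ‖fun j : (ZMod m × Bool) × (Fin p × Fin n) => aco p n m φ j.1 j.2‖

lemma PG_Kf : PG (Kf p n m) := PG.pinorm fun j => PG_aco j.1 j.2

lemma Kf_nonneg (φ : Fin p → Fin m → ℝ) : 0 ≤ Kf p n m φ := norm_nonneg _

lemma aco_le_Kf (φ : Fin p → Fin m → ℝ) (j : ZMod m × Bool) (ik : Fin p × Fin n) :
    |aco p n m φ j ik| ≤ Kf p n m φ :=
  norm_le_pi_norm (fun j : (ZMod m × Bool) × (Fin p × Fin n) => aco p n m φ j.1 j.2) (j, ik)

lemma pinorm_pow_le {τ : Type*} [Fintype τ] (f : τ → ℝ) (q : ℕ) (hq : 1 ≤ q) :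
    ‖f‖ ^ (2 * q) ≤ ∑ b, f b ^ (2 * q) := by
  rcases isEmpty_or_nonempty τ with h | h
  · have : ‖f‖ = 0 := by simp [Subsingleton.elim f 0]
    rw [this, zero_pow (by omega)]; simp
  · obtain ⟨b0, hb0⟩ := Finite.exists_max (fun b => ‖f b‖)
    have h1 : ‖f‖ ≤ ‖f b0‖ := (pi_norm_le_iff_of_nonneg (norm_nonneg _)).mpr hb0
    calc ‖f‖ ^ (2 * q) ≤ ‖f b0‖ ^ (2 * q) := by gcongr
      _ = f b0 ^ (2 * q) := by rw [Real.norm_eq_abs, (even_two_mul q).pow_abs]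
      _ ≤ _ := Finset.single_le_sum (f := fun b => f b ^ (2 * q))
          (fun b _ => (even_two_mul q).pow_nonneg _) (Finset.mem_univ b0)

lemma Kf_mom (q : ℕ) (hq : 1 ≤ q) :
    ∫ φ, Kf p n m φ ^ (2 * q) ∂(gaussMeasure p m) ≤ (2 * m * (n * p)) * (16 * q) ^ q := by
  calc ∫ φ, Kf p n m φ ^ (2 * q) ∂(gaussMeasure p m)
      ≤ ∫ φ, ∑ j : (ZMod m × Bool) × (Fin p × Fin n), aco p n m φ j.1 j.2 ^ (2 * q) ∂(gaussMeasure p m) := by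
        refine integral_mono (PG_Kf.pow _).integrable (PG.integrable ?_) fun φ => ?_
        · exact PG.sum _ fun j _ => (PG_aco j.1 j.2).pow _
        · exact pinorm_pow_le _ q hq
    _ = ∑ j : (ZMod m × Bool) × (Fin p × Fin n), ∫ φ, aco p n m φ j.1 j.2 ^ (2 * q) ∂(gaussMeasure p m) :=
        integral_finsetSum _ fun j _ => ((PG_aco j.1 j.2).pow _).integrable
    _ ≤ ∑ j : (ZMod m × Bool) × (Fin p × Fin n), (16 * (q : ℝ)) ^ q :=
        Finset.sum_le_sum fun j _ => gauss_mom (acoL j.1 j.2) (Qf_acoL _ _) q hq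
    _ = _ := by
        simp [ZMod.card]; ring

end Mom

open MeasureTheory ProbabilityTheory Matrix

/-! ### Symmetrization -/

set_option linter.unusedSectionVars false
section Sym
variable {p n m : ℕ} [NeZero m] {τ : Type*} [Fintype τ]

lemma PG.comp_le {E F : Type*} [NormedAddCommGroup E] [NormedAddCommGroup F] {f : E → ℝ} (hf : PG f)
    (g : F → E) (hg : Continuous g) (hn : ∀ z, ‖g z‖ ≤ ‖z‖) : PG (fun z => f (g z)) := by
  obtain ⟨h1, C, k, hC, h⟩ := hf
  refine ⟨h1.comp hg, C, k, hC, fun z => (h _).trans ?_⟩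
  gcongr
  exact hn z

/-- deviation -/
noncomputable def Xf (p n m : ℕ) [NeZero m] (z : τ → Fin p × Fin n → ℝ) (φ : Fin p → Fin m → ℝ) : ℝ :=
  ‖fun b => nrm p n m φ (z b) - ∑ ik, z b ik ^ 2‖

lemma PG_Xf (z : τ → Fin p × Fin n → ℝ) : PG (Xf p n m z) :=
  PG.pinorm fun b => (PG_nrm (z b)).sub (PG.const _)

lemma Xf_nonneg (z : τ → Fin p × Fin n → ℝ) (φ : Fin p → Fin m → ℝ) : 0 ≤ Xf p n m z φ :=
  norm_nonneg _

/-- difference process -/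
noncomputable def Vf (p n m : ℕ) [NeZero m] (z : τ → Fin p × Fin n → ℝ)
    (w : (Fin p → Fin m → ℝ) × (Fin p → Fin m → ℝ)) : ℝ :=
  ‖fun b => nrm p n m w.1 (z b) - nrm p n m w.2 (z b)‖

lemma PG_Vf (z : τ → Fin p × Fin n → ℝ) : PG (Vf p n m z) :=
  PG.pinorm fun b => ((PG_nrm (z b)).comp_le Prod.fst continuous_fst norm_fst_le).sub
    ((PG_nrm (z b)).comp_le Prod.snd continuous_snd norm_snd_le)

lemma PG_Vf' (z : τ → Fin p × Fin n → ℝ) (φ : Fin p → Fin m → ℝ) : PG (fun ψ => Vf p n m z (φ, ψ)) :=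
  PG.pinorm (f := fun b ψ => nrm p n m φ (z b) - nrm p n m ψ (z b))
    fun b => (PG.const _).sub (PG_nrm (z b))

/-- signed process -/
noncomputable def Wf (p n m : ℕ) [NeZero m] (z : τ → Fin p × Fin n → ℝ) (η : ZMod m → Bool)
    (φ : Fin p → Fin m → ℝ) : ℝ :=
  ‖fun b => quad p n m η φ (z b)‖

lemma PG_Wf (z : τ → Fin p × Fin n → ℝ) (η : ZMod m → Bool) : PG (Wf p n m z η) :=
  PG.pinorm fun b => PG_quad η (z b)

lemma Xf_le (hnm : n ≤ m) (z : τ → Fin p × Fin n → ℝ) (φ : Fin p → Fin m → ℝ) :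
    Xf p n m z φ ≤ ∫ ψ, Vf p n m z (φ, ψ) ∂(gaussMeasure p m) := by
  unfold Xf
  have h0 : 0 ≤ ∫ ψ, Vf p n m z (φ, ψ) ∂(gaussMeasure p m) :=
    integral_nonneg fun _ => norm_nonneg _
  rw [pi_norm_le_iff_of_nonneg h0]
  intro b
  have h : nrm p n m φ (z b) - ∑ ik, z b ik ^ 2 =
      ∫ ψ, (nrm p n m φ (z b) - nrm p n m ψ (z b)) ∂(gaussMeasure p m) := by
    rw [integral_sub (integrable_const _) (PG_nrm (z b)).integrable, nrm_integral hnm]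
    simp
  rw [h]
  refine (norm_integral_le_integral_norm _).trans ?_
  refine integral_mono ?_ (PG_Vf' z φ).integrable fun ψ => ?_
  · exact ((PG.const _).sub (PG_nrm (z b))).integrable.norm
  · exact norm_le_pi_norm (fun b => nrm p n m φ (z b) - nrm p n m ψ (z b)) b

lemma Xf_pow_le (hnm : n ≤ m) (z : τ → Fin p × Fin n → ℝ) (l : ℕ) :
    ∫ φ, Xf p n m z φ ^ l ∂(gaussMeasure p m) ≤
      ∫ w, Vf p n m z w ^ l ∂((gaussMeasure p m).prod (gaussMeasure p m)) := by
  have hV : Integrable (fun w => Vf p n m z w ^ l) ((gaussMeasure p m).prod (gaussMeasure p m)) :=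
    ((PG_Vf z).pow l).integrable
  rw [integral_prod _ hV]
  refine integral_mono ((PG_Xf z).pow l).integrable hV.integral_prod_left fun φ => ?_
  have h1 : Xf p n m z φ ^ l ≤ (∫ ψ, Vf p n m z (φ, ψ) ∂(gaussMeasure p m)) ^ l :=
    pow_le_pow_left₀ (Xf_nonneg z φ) (Xf_le hnm z φ) l
  refine h1.trans ?_
  exact (convexOn_pow (𝕜 := ℝ) l).map_integral_le (by fun_prop) isClosed_Ici
    (Filter.Eventually.of_forall fun ψ => norm_nonneg _) (PG_Vf' z φ).integrable
    ((PG_Vf' z φ).pow l).integrable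

lemma Vf_swp (z : τ → Fin p × Fin n → ℝ) (η : ZMod m → Bool)
    (w : (Fin p → Fin m → ℝ) × (Fin p → Fin m → ℝ)) :
    Vf p n m z (swp η w) ≤ Wf p n m z η w.1 + Wf p n m z η w.2 := by
  unfold Vf Wf
  have : (fun b => nrm p n m (swp η w).1 (z b) - nrm p n m (swp η w).2 (z b)) =
      (fun b => quad p n m η w.1 (z b)) - (fun b => quad p n m η w.2 (z b)) := by
    ext b; exact swp_diff η w.1 w.2 (z b)
  rw [this]
  exact norm_sub_le _ _

lemma symm_bound (hnm : n ≤ m) (z : τ → Fin p × Fin n → ℝ) (η : ZMod m → Bool) (l : ℕ) (hl : 1 ≤ l) :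
    ∫ φ, Xf p n m z φ ^ l ∂(gaussMeasure p m) ≤
      2 ^ l * ∫ φ, Wf p n m z η φ ^ l ∂(gaussMeasure p m) := by
  refine (Xf_pow_le hnm z l).trans ?_
  set μ := gaussMeasure p m with hμ
  have hsc : Continuous (swp (p := p) η) := (swp (p := p) η).continuous_of_finiteDimensional
  have e1 : ∫ w, Vf p n m z w ^ l ∂(μ.prod μ) = ∫ w, Vf p n m z (swp η w) ^ l ∂(μ.prod μ) := by
    conv_lhs => rw [hμ, ← swp_preserves η]
    rw [integral_map hsc.measurable.aemeasurable]
    exact ((PG_Vf z).pow l).1.aestronglyMeasurable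
  rw [e1]
  have i1 : Integrable (fun w : (Fin p → Fin m → ℝ) × (Fin p → Fin m → ℝ) =>
      Wf p n m z η w.1 ^ l) (μ.prod μ) :=
    ((PG_Wf z η).pow l |>.comp_le Prod.fst continuous_fst norm_fst_le).integrable
  have i2 : Integrable (fun w : (Fin p → Fin m → ℝ) × (Fin p → Fin m → ℝ) =>
      Wf p n m z η w.2 ^ l) (μ.prod μ) :=
    ((PG_Wf z η).pow l |>.comp_le Prod.snd continuous_snd norm_snd_le).integrable
  calc ∫ w, Vf p n m z (swp η w) ^ l ∂(μ.prod μ)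
      ≤ ∫ w, 2 ^ (l - 1) * (Wf p n m z η w.1 ^ l + Wf p n m z η w.2 ^ l) ∂(μ.prod μ) := by
        refine integral_mono_of_nonneg (Filter.Eventually.of_forall fun w => ?_)
          ((i1.add i2).const_mul _) (Filter.Eventually.of_forall fun w => ?_)
        · exact pow_nonneg (norm_nonneg _) _
        · calc Vf p n m z (swp η w) ^ l ≤ (Wf p n m z η w.1 + Wf p n m z η w.2) ^ l :=
                pow_le_pow_left₀ (norm_nonneg _) (Vf_swp z η w) l
            _ ≤ _ := add_pow_le (norm_nonneg _) (norm_nonneg _) l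
    _ = 2 ^ (l - 1) * (∫ φ, Wf p n m z η φ ^ l ∂μ + ∫ φ, Wf p n m z η φ ^ l ∂μ) := by
        rw [integral_const_mul, integral_add i1 i2]
        congr 2
        · rw [integral_fun_fst (μ := μ) (ν := μ) (fun φ => Wf p n m z η φ ^ l)]; simp
        · rw [integral_fun_snd (μ := μ) (ν := μ) (fun φ => Wf p n m z η φ ^ l)]; simp
    _ = _ := by
        obtain ⟨k, rfl⟩ : ∃ k, l = k + 1 := ⟨l - 1, by omega⟩
        rw [Nat.add_sub_cancel, pow_succ]; ring

/-- pointwise chaining bound -/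
lemma chain_point [Nonempty τ] (z : τ → Fin p × Fin n → ℝ) (S : ℝ) (hS : 0 < S)
    (hz1 : ∀ b, ∑ ik, |z b ik| ≤ S) (hz2 : ∀ b, ∑ ik, z b ik ^ 2 ≤ 1)
    (r : ℕ) (hr : 1 ≤ r) (hJ : 4 * (m : ℝ) ≤ Real.exp (3 * r))
    (hN : 2 * ((n : ℝ) * p) + 1 ≤ Real.exp (3 * r)) (φ : Fin p → Fin m → ℝ) :
    ∑ η : ZMod m → Bool, Wf p n m z η φ ^ (2 * r) ≤
      2 ^ Fintype.card (ZMod m) * (36 * 10 ^ 9 * r ^ 4 * S ^ 2 / m) ^ r *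
        ((1 + Kf p n m φ) ^ (2 * r) * (1 + Xf p n m z φ) ^ r) := by
  have hm : (0 : ℝ) < m := by exact_mod_cast NeZero.pos m
  have hK : 0 < 1 + Kf p n m φ := by linarith [Kf_nonneg (n := n) φ]
  have hX : 0 < 1 + Xf p n m z φ := by linarith [Xf_nonneg z φ]
  set K := 1 + Kf p n m φ with hKd
  set R2 := (m : ℝ) * (1 + Xf p n m z φ) with hR2
  have hR : 0 < R2 := by positivity
  set a : ZMod m × Bool → Fin p × Fin n → ℝ := aco p n m φ with ha
  have hsel : ∀ η : ZMod m → Bool, ∃ b : τ, Wf p n m z η φ ≤ |quad p n m η φ (z b)| := by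
    intro η
    obtain ⟨b0, hb0⟩ := Finite.exists_max (fun b => ‖quad p n m η φ (z b)‖)
    exact ⟨b0, (pi_norm_le_iff_of_nonneg (norm_nonneg _)).mpr hb0⟩
  choose b hb using hsel
  have hc := aux_chain a (fun j => repZ j.1) (fun c => repZ_card c) K S R2 r hK hS hR
    (fun j i => (aco_le_Kf φ j i).trans (by linarith))
    {x | ∑ i, |x i| ≤ S ∧ ∑ j, (a j ⬝ᵥ x) ^ 2 ≤ R2}
    (by simp [hS.le, hR.le]) (fun x hx => hx.1) (fun x hx => hx.2) hr
    (by simp [ZMod.card]; linarith) (by simp [ZMod.card]; linarith)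
    (fun η => z (b η))
    (by
      intro η
      refine ⟨hz1 _, ?_⟩
      rw [ha, aco_parseval, hR2]
      gcongr
      have h1 : |nrm p n m φ (z (b η)) - ∑ ik, z (b η) ik ^ 2| ≤ Xf p n m z φ :=
        norm_le_pi_norm (fun b => nrm p n m φ (z b) - ∑ ik, z b ik ^ 2) (b η)
      have h2 := le_abs_self (nrm p n m φ (z (b η)) - ∑ ik, z (b η) ik ^ 2)
      linarith [hz2 (b η)])
  have hq : ∀ η, Wf p n m z η φ ^ (2 * r) ≤ (m : ℝ)⁻¹ ^ (2 * r) *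
      (∑ j : ZMod m × Bool, sg (η (repZ j.1)) * (a j ⬝ᵥ z (b η)) ^ 2) ^ (2 * r) := by
    intro η
    rw [← mul_pow, ← (even_two_mul r).pow_abs (_ * _)]
    exact pow_le_pow_left₀ (norm_nonneg _) (hb η) _
  calc ∑ η : ZMod m → Bool, Wf p n m z η φ ^ (2 * r)
      ≤ ∑ η : ZMod m → Bool, (m : ℝ)⁻¹ ^ (2 * r) *
      (∑ j : ZMod m × Bool, sg (η (repZ j.1)) * (a j ⬝ᵥ z (b η)) ^ 2) ^ (2 * r) :=
        Finset.sum_le_sum fun η _ => hq η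
    _ ≤ (m : ℝ)⁻¹ ^ (2 * r) * (2 ^ Fintype.card (ZMod m) *
          (36 * 10 ^ 9 * r ^ 4 * (S ^ 2 * K ^ 2 * R2)) ^ r) := by
        rw [← Finset.mul_sum]
        gcongr
    _ = _ := by
        have e : (m : ℝ)⁻¹ ^ 2 * (36 * 10 ^ 9 * r ^ 4 * (S ^ 2 * K ^ 2 * R2)) =
            36 * 10 ^ 9 * r ^ 4 * S ^ 2 / m * (K ^ 2 * (1 + Xf p n m z φ)) := by
          rw [hR2]; field_simp
        calc _ = 2 ^ Fintype.card (ZMod m) *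
              ((m : ℝ)⁻¹ ^ 2 * (36 * 10 ^ 9 * r ^ 4 * (S ^ 2 * K ^ 2 * R2))) ^ r := by
              rw [pow_mul, mul_pow ((m : ℝ)⁻¹ ^ 2)]; ring
          _ = _ := by rw [e, mul_pow, mul_pow, ← pow_mul]; ring

end Sym

open MeasureTheory ProbabilityTheory Matrix

/-! ### Moment bound and tail -/

set_option linter.unusedSectionVars false
section Tail
variable {p n m : ℕ} [NeZero m] {τ : Type*} [Fintype τ] [Nonempty τ]

lemma one_add_pow_le (x : ℝ) (hx : 0 ≤ x) (l : ℕ) : (1 + x) ^ l ≤ 2 ^ l * (1 + x ^ l) := by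
  refine (add_pow_le zero_le_one hx l).trans ?_
  rw [one_pow]
  gcongr
  · norm_num
  · omega

lemma moment1 (hnm : n ≤ m) (z : τ → Fin p × Fin n → ℝ) (S : ℝ) (hS : 0 < S)
    (hz1 : ∀ b, ∑ ik, |z b ik| ≤ S) (hz2 : ∀ b, ∑ ik, z b ik ^ 2 ≤ 1)
    (r : ℕ) (hr : 1 ≤ r) (hJ : 4 * (m : ℝ) ≤ Real.exp (3 * r))
    (hN : 2 * ((n : ℝ) * p) + 1 ≤ Real.exp (3 * r)) :
    ∫ φ, Xf p n m z φ ^ (2 * r) ∂(gaussMeasure p m) ≤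
      (4 * (36 * 10 ^ 9 * r ^ 4 * S ^ 2 / m)) ^ r *
        ∫ φ, (1 + Kf p n m φ) ^ (2 * r) * (1 + Xf p n m z φ) ^ r ∂(gaussMeasure p m) := by
  set μ := gaussMeasure p m with hμ
  set Y := ∫ φ, Xf p n m z φ ^ (2 * r) ∂μ with hY
  set A0 : ℝ := 36 * 10 ^ 9 * r ^ 4 * S ^ 2 / m with hA0
  set c := Fintype.card (ZMod m) with hc
  have h1 : (2 : ℝ) ^ c * Y ≤ ∑ η : ZMod m → Bool, 2 ^ (2 * r) * ∫ φ, Wf p n m z η φ ^ (2 * r) ∂μ := by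
    have : (2 : ℝ) ^ c * Y = ∑ η : ZMod m → Bool, Y := by simp [hc]
    rw [this]
    exact Finset.sum_le_sum fun η _ => symm_bound hnm z η (2 * r) (by omega)
  have hIntg : Integrable (fun φ => (1 + Kf p n m φ) ^ (2 * r) * (1 + Xf p n m z φ) ^ r) μ :=
    ((((PG.const 1).add PG_Kf).pow _).mul (((PG.const 1).add (PG_Xf z)).pow _)).integrable
  have h2 : ∑ η : ZMod m → Bool, ∫ φ, Wf p n m z η φ ^ (2 * r) ∂μ ≤
      2 ^ c * A0 ^ r * ∫ φ, (1 + Kf p n m φ) ^ (2 * r) * (1 + Xf p n m z φ) ^ r ∂μ := by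
    rw [← integral_finsetSum _ fun η _ => ((PG_Wf z η).pow _).integrable, ← integral_const_mul]
    refine integral_mono (PG.integrable (PG.sum _ fun η _ => (PG_Wf z η).pow _)) (hIntg.const_mul _)
      fun φ => ?_
    exact chain_point z S hS hz1 hz2 r hr hJ hN φ
  rw [← Finset.mul_sum] at h1
  have h3 : (2 : ℝ) ^ c * Y ≤ 2 ^ c * ((4 * A0) ^ r *
      ∫ φ, (1 + Kf p n m φ) ^ (2 * r) * (1 + Xf p n m z φ) ^ r ∂μ) := by
    calc (2 : ℝ) ^ c * Y ≤ _ := h1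
      _ ≤ 2 ^ (2 * r) * (2 ^ c * A0 ^ r *
          ∫ φ, (1 + Kf p n m φ) ^ (2 * r) * (1 + Xf p n m z φ) ^ r ∂μ) := by gcongr
      _ = _ := by rw [pow_mul, mul_pow]; norm_num; ring
  exact le_of_mul_le_mul_left h3 (by positivity)

lemma young (a u v lam : ℝ) (h : 0 < lam) : a * (u * v) ≤ 2⁻¹ * (lam * (a ^ 2 * u ^ 2) + lam⁻¹ * v ^ 2) := by
  have h1 : 0 ≤ lam⁻¹ * (lam * (a * u) - v) ^ 2 := by positivity
  have h2 : lam⁻¹ * (lam * (a * u) - v) ^ 2 = lam * (a ^ 2 * u ^ 2) + lam⁻¹ * v ^ 2 - 2 * (a * (u * v)) := by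
    field_simp; ring
  linarith

lemma arith1 (A B N q : ℝ) (r : ℕ) :
    2 * (2⁻¹ * (4 ^ r * B) * ((4 * A) ^ r) ^ 2 * 16 ^ r) * (3 * N ^ 2 * (1024 * q ^ 2) ^ r) =
      (2 ^ 20 * A ^ 2 * q ^ 2) ^ r * (3 * N ^ 2) * B := by
  have h : (2 ^ 20 * A ^ 2 * q ^ 2) ^ r = 4 ^ r * ((4 * A) ^ r) ^ 2 * 16 ^ r * (1024 * q ^ 2) ^ r := by
    rw [← pow_mul, mul_comm r 2, pow_mul, ← mul_pow, ← mul_pow, ← mul_pow]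
    congr 1
    ring
  rw [h]
  ring

lemma arith2 (r L : ℝ) (hL : 0.69 ≤ L) (hr0 : 0 ≤ r) (hr : r ≤ L + 1) : r ^ 5 ≤ 440 * L ^ 6 := by
  have h1 : r ≤ 2.5 * L := by linarith
  have h5 : 0 ≤ L ^ 5 := by positivity
  calc r ^ 5 ≤ (2.5 * L) ^ 5 := by gcongr
    _ = 97.65625 * L ^ 5 := by ring
    _ ≤ 440 * L ^ 5 * L := by nlinarith
    _ = _ := by ring

lemma arith3 (r L e s m δ : ℝ) (hr0 : 0 ≤ r) (hs : 0 ≤ s) (hL : 0 ≤ L) (hm : 0 < m) (hδ : 0 < δ)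
    (he0 : 0 ≤ e) (he4 : e ^ 4 ≤ 55) (hr5 : r ^ 5 ≤ 440 * L ^ 6)
    (hbig : 10 ^ 18 * δ⁻¹ ^ 2 * s * L ^ 6 ≤ m) :
    1024 * (36 * 10 ^ 9 * r ^ 4 * s / m) * r * e ^ 4 ≤ δ ^ 2 := by
  have hbig' : 10 ^ 18 * s * L ^ 6 ≤ m * δ ^ 2 := by
    calc 10 ^ 18 * s * L ^ 6 = (10 ^ 18 * δ⁻¹ ^ 2 * s * L ^ 6) * δ ^ 2 := by field_simp
      _ ≤ _ := mul_le_mul_of_nonneg_right hbig (by positivity)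
  have h1 : 1024 * (36 * 10 ^ 9 * r ^ 4 * s / m) * r * e ^ 4 =
      ((1024 * 36 * 10 ^ 9) * (s * (e ^ 4 * r ^ 5))) / m := by ring
  rw [h1, div_le_iff₀ hm, mul_comm (δ ^ 2)]
  refine le_trans ?_ hbig'
  have h2 : e ^ 4 * r ^ 5 ≤ 55 * (440 * L ^ 6) :=
    mul_le_mul he4 hr5 (by positivity) (by norm_num)
  have h3 : s * (e ^ 4 * r ^ 5) ≤ s * (55 * (440 * L ^ 6)) := mul_le_mul_of_nonneg_left h2 hs
  have h4 : 0 ≤ s * L ^ 6 := by positivity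
  norm_num
  nlinarith

lemma moment2 (hnm : n ≤ m) (hmN : m ≤ n * p) (z : τ → Fin p × Fin n → ℝ) (S : ℝ) (hS : 0 < S)
    (hz1 : ∀ b, ∑ ik, |z b ik| ≤ S) (hz2 : ∀ b, ∑ ik, z b ik ^ 2 ≤ 1)
    (r : ℕ) (hr : 1 ≤ r) (hJ : 4 * (m : ℝ) ≤ Real.exp (3 * r))
    (hN : 2 * ((n : ℝ) * p) + 1 ≤ Real.exp (3 * r)) (B : ℝ) (hB : 1 ≤ B) :
    ∫ φ, Xf p n m z φ ^ (2 * r) ∂(gaussMeasure p m) ≤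
      (2 ^ 20 * (36 * 10 ^ 9 * r ^ 4 * S ^ 2 / m) ^ 2 * r ^ 2) ^ r * (3 * ((n : ℝ) * p) ^ 2) * B + B⁻¹ := by
  have h1 := moment1 hnm z S hS hz1 hz2 r hr hJ hN
  have hm : (1 : ℝ) ≤ m := by exact_mod_cast NeZero.pos m
  have hmN' : (m : ℝ) ≤ (n : ℝ) * p := by exact_mod_cast hmN
  have hr' : (1 : ℝ) ≤ r := by exact_mod_cast hr
  set μ := gaussMeasure p m with hμ
  set Y := ∫ φ, Xf p n m z φ ^ (2 * r) ∂μ with hY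
  set A0 : ℝ := 36 * 10 ^ 9 * r ^ 4 * S ^ 2 / m with hA0
  have hA0p : 0 < A0 := by positivity
  have hB0 : 0 < B := by linarith
  have hK := Kf_mom (p := p) (n := n) (m := m) (2 * r) (by omega)
  rw [← hμ] at hK
  set M := ∫ φ, Kf p n m φ ^ (2 * (2 * r)) ∂μ with hM
  set N : ℝ := (n : ℝ) * p with hNd
  have hY0 : 0 ≤ Y := integral_nonneg fun φ => pow_nonneg (Xf_nonneg z φ) _
  have iK : Integrable (fun φ => Kf p n m φ ^ (2 * (2 * r))) μ := (PG_Kf.pow _).integrable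
  have iX : Integrable (fun φ => Xf p n m z φ ^ (2 * r)) μ := ((PG_Xf z).pow _).integrable
  set c1 : ℝ := 2⁻¹ * (4 ^ r * B) * ((4 * A0) ^ r) ^ 2 * 16 ^ r with hc1
  have hpt : ∀ φ, (4 * A0) ^ r * ((1 + Kf p n m φ) ^ (2 * r) * (1 + Xf p n m z φ) ^ r) ≤
      c1 * (1 + Kf p n m φ ^ (2 * (2 * r))) + 2⁻¹ * B⁻¹ * (1 + Xf p n m z φ ^ (2 * r)) := by
    intro φ
    refine (young _ _ _ (4 ^ r * B) (by positivity)).trans ?_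
    have e1 := one_add_pow_le _ (Kf_nonneg (n := n) φ) (2 * (2 * r))
    have e2 := one_add_pow_le _ (Xf_nonneg z φ) (2 * r)
    have f1 : ((1 + Kf p n m φ) ^ (2 * r)) ^ 2 ≤ 16 ^ r * (1 + Kf p n m φ ^ (2 * (2 * r))) := by
      rw [← pow_mul, mul_comm (2 * r) 2]
      refine e1.trans (le_of_eq ?_)
      congr 1
      rw [← mul_assoc, pow_mul]; norm_num
    have f2 : ((1 + Xf p n m z φ) ^ r) ^ 2 ≤ 4 ^ r * (1 + Xf p n m z φ ^ (2 * r)) := by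
      rw [← pow_mul, mul_comm r 2]
      refine e2.trans (le_of_eq ?_)
      congr 1
      rw [pow_mul]; norm_num
    calc 2⁻¹ * (4 ^ r * B * (((4 * A0) ^ r) ^ 2 * ((1 + Kf p n m φ) ^ (2 * r)) ^ 2) +
          (4 ^ r * B)⁻¹ * ((1 + Xf p n m z φ) ^ r) ^ 2)
        ≤ 2⁻¹ * (4 ^ r * B * (((4 * A0) ^ r) ^ 2 * (16 ^ r * (1 + Kf p n m φ ^ (2 * (2 * r))))) +
          (4 ^ r * B)⁻¹ * (4 ^ r * (1 + Xf p n m z φ ^ (2 * r)))) := by gcongr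
      _ = _ := by
          rw [hc1]
          have : (4 : ℝ) ^ r ≠ 0 := by positivity
          field_simp
  have h2 : Y ≤ c1 * (1 + M) + 2⁻¹ * B⁻¹ * (1 + Y) := by
    refine h1.trans ?_
    rw [← integral_const_mul]
    have j1 : Integrable (fun φ => c1 * (1 + Kf p n m φ ^ (2 * (2 * r)))) μ :=
      ((integrable_const 1).add iK).const_mul _
    have j2 : Integrable (fun φ => 2⁻¹ * B⁻¹ * (1 + Xf p n m z φ ^ (2 * r))) μ :=
      ((integrable_const 1).add iX).const_mul _
    calc _ ≤ ∫ φ, (c1 * (1 + Kf p n m φ ^ (2 * (2 * r))) + 2⁻¹ * B⁻¹ * (1 + Xf p n m z φ ^ (2 * r))) ∂μ := by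
          refine integral_mono_of_nonneg (Filter.Eventually.of_forall fun φ => ?_) (j1.add j2)
            (Filter.Eventually.of_forall hpt)
          have := Kf_nonneg (n := n) φ
          have := Xf_nonneg z φ
          simp only [Pi.zero_apply]
          positivity
      _ = _ := by
          rw [integral_add j1 j2, integral_const_mul, integral_const_mul,
            integral_add (integrable_const _) iK, integral_add (integrable_const _) iX]
          simp [hμ, hM, hY]
  have h3 : 1 + M ≤ 3 * N ^ 2 * (1024 * r ^ 2) ^ r := by
    have e : (16 * ((2 * r : ℕ) : ℝ)) ^ (2 * r) = (1024 * r ^ 2) ^ r := by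
      rw [pow_mul]; congr 1; push_cast; ring
    rw [e] at hK
    have g : (1 : ℝ) ≤ (1024 * r ^ 2) ^ r := one_le_pow₀ (by nlinarith)
    have g2 : 1 ≤ N := hm.trans hmN'
    have g3 : 2 * (m : ℝ) * N ≤ 2 * N ^ 2 := by nlinarith
    have g4 : 1 ≤ N ^ 2 := by nlinarith
    calc 1 + M ≤ N ^ 2 * (1024 * r ^ 2) ^ r + 2 * N ^ 2 * (1024 * r ^ 2) ^ r := by
          refine add_le_add (by nlinarith) (hK.trans ?_)
          gcongr
      _ = _ := by ring
  have h4 : B⁻¹ ≤ 1 := inv_le_one_of_one_le₀ hB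
  have h5 : Y ≤ 2 * c1 * (1 + M) + B⁻¹ := by nlinarith
  refine h5.trans ?_
  refine add_le_add ?_ le_rfl
  have hc1p : 0 ≤ 2 * c1 := by positivity
  refine (mul_le_mul_of_nonneg_left h3 hc1p).trans (le_of_eq ?_)
  exact arith1 A0 B N r r

set_option maxHeartbeats 1000000 in
lemma tail (hn : 1 ≤ n) (hnm : n ≤ m) (hmN : m ≤ n * p) (hN2 : 2 ≤ n * p) (s : ℕ) (hs : 1 ≤ s)
    (δ : ℝ) (hδ : 0 < δ) (hδ1 : δ ≤ 1)
    (hbig : 10 ^ 18 * δ⁻¹ ^ 2 * s * (Real.log ((n : ℝ) * p)) ^ 6 ≤ m)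
    (z : τ → Fin p × Fin n → ℝ)
    (hz1 : ∀ b, ∑ ik, |z b ik| ≤ Real.sqrt s) (hz2 : ∀ b, ∑ ik, z b ik ^ 2 ≤ 1) :
    (gaussMeasure p m).real {φ | δ < Xf p n m z φ} ≤ ((n : ℝ) * p)⁻¹ := by
  have hm : (1 : ℝ) ≤ m := by exact_mod_cast NeZero.pos m
  have hmN' : (m : ℝ) ≤ (n : ℝ) * p := by exact_mod_cast hmN
  have hN2' : (2 : ℝ) ≤ (n : ℝ) * p := by exact_mod_cast hN2
  have hs' : (1 : ℝ) ≤ s := by exact_mod_cast hs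
  set N : ℝ := (n : ℝ) * p with hN
  set L := Real.log N with hL
  have hN0 : 0 < N := by linarith
  have hL2 : 0.69 ≤ L := by
    have := Real.log_le_log (by norm_num) hN2'
    linarith [Real.log_two_gt_d9]
  set r := ⌈L⌉₊ with hrd
  have hr : 1 ≤ r := Nat.one_le_iff_ne_zero.mpr (by
    intro h; have := Nat.le_ceil L; rw [← hrd, h] at this; norm_num at this; linarith)
  have hr1 : L ≤ r := Nat.le_ceil L
  have hr2 : (r : ℝ) < L + 1 := Nat.ceil_lt_add_one (by linarith)
  have hr' : (1 : ℝ) ≤ r := by exact_mod_cast hr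
  have hNe : N ≤ Real.exp r := by
    rw [← Real.exp_log hN0]; exact Real.exp_le_exp.mpr hr1
  set e := Real.exp 1 with he
  have he1 : 2.7 < e := by linarith [Real.exp_one_gt_d9]
  have he2 : e < 2.7183 := by linarith [Real.exp_one_lt_d9]
  have hexp : ∀ k : ℕ, Real.exp (k * r) = (e ^ k) ^ r := by
    intro k; rw [he, ← Real.exp_nat_mul, ← Real.exp_nat_mul]; congr 1; push_cast; ring
  have hNe' : N ≤ e ^ r := by
    have := hexp 1; rw [Nat.cast_one, one_mul, pow_one] at this; rw [← this]; exact hNe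
  have her : e ≤ e ^ r := by
    calc e = e ^ 1 := (pow_one _).symm
      _ ≤ e ^ r := pow_le_pow_right₀ (by linarith) hr
  have h3 : Real.exp (3 * r) = e ^ r * e ^ r * e ^ r := by
    have := hexp 3; push_cast at this; rw [this, ← pow_mul, mul_comm 3 r, pow_mul]; ring
  have h49 : 2.7 * 2.7 ≤ e ^ r * e ^ r := by nlinarith
  have hJ : 4 * (m : ℝ) ≤ Real.exp (3 * r) := by rw [h3]; nlinarith
  have hN3 : 2 * N + 1 ≤ Real.exp (3 * r) := by rw [h3]; nlinarith
  have hsq : Real.sqrt s ^ 2 = s := Real.sq_sqrt (by positivity)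
  set B : ℝ := (e ^ 2 / δ ^ 2) ^ r with hB
  have hδ2 : δ ^ 2 ≤ 1 := pow_le_one₀ hδ.le hδ1
  have hB1 : 1 ≤ B := one_le_pow₀ (by rw [le_div_iff₀ (by positivity)]; nlinarith)
  have hY := moment2 hnm hmN z (Real.sqrt s) (Real.sqrt_pos.mpr (by linarith)) hz1 hz2 r hr hJ hN3 B hB1
  rw [hsq, ← hN] at hY
  set A0 : ℝ := 36 * 10 ^ 9 * r ^ 4 * s / m with hA0
  have hr5 : (r : ℝ) ^ 5 ≤ 440 * L ^ 6 := arith2 _ _ hL2 (by linarith) hr2.le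
  have he4 : e ^ 4 ≤ 55 := by
    calc e ^ 4 ≤ 2.7183 ^ 4 := by gcongr
      _ ≤ 55 := by norm_num
  have hkey : 1024 * A0 * r * e ^ 4 ≤ δ ^ 2 :=
    arith3 r L e s m δ (by linarith) (by linarith) (by linarith) (by linarith) hδ (by linarith)
      he4 hr5 hbig
  have hA0p : 0 ≤ A0 := by positivity
  clear_value A0 e L N
  have hkey2 : 2 ^ 20 * A0 ^ 2 * r ^ 2 * e ^ 8 ≤ δ ^ 4 := by
    calc 2 ^ 20 * A0 ^ 2 * r ^ 2 * e ^ 8 = (1024 * A0 * r * e ^ 4) ^ 2 := by ring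
      _ ≤ (δ ^ 2) ^ 2 := by gcongr
      _ = _ := by ring
  have he0 : 0 < e := by linarith
  -- Markov
  have hmk := mul_meas_ge_le_integral_of_nonneg (μ := gaussMeasure p m)
    (f := fun φ => Xf p n m z φ ^ (2 * r))
    (Filter.Eventually.of_forall fun φ => pow_nonneg (Xf_nonneg z φ) _)
    ((PG_Xf z).pow _).integrable (δ ^ (2 * r))
  have hsub : (gaussMeasure p m).real {φ | δ < Xf p n m z φ} ≤
      (gaussMeasure p m).real {φ | δ ^ (2 * r) ≤ Xf p n m z φ ^ (2 * r)} := by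
    refine measureReal_mono ?_ (measure_ne_top _ _)
    intro φ hφ
    exact pow_le_pow_left₀ hδ.le (le_of_lt hφ) _
  set P := (gaussMeasure p m).real {φ | δ < Xf p n m z φ} with hP
  have hδr : 0 < δ ^ (2 * r) := by positivity
  have h6 : δ ^ (2 * r) * P ≤ (2 ^ 20 * A0 ^ 2 * r ^ 2) ^ r * (3 * N ^ 2) * B + B⁻¹ :=
    (mul_le_mul_of_nonneg_left hsub hδr.le).trans (hmk.trans hY)
  have hBi : B⁻¹ = δ ^ (2 * r) * ((e ^ 2)⁻¹) ^ r := by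
    rw [hB, ← inv_pow, inv_div, div_eq_mul_inv, mul_pow, pow_mul]
  have h7 : (2 ^ 20 * A0 ^ 2 * r ^ 2) ^ r * (3 * N ^ 2) * B ≤ δ ^ (2 * r) * ((e ^ 2)⁻¹) ^ r := by
    have g1 : 3 * N ^ 2 ≤ (e ^ 4) ^ r := by
      have : (e ^ 4) ^ r = (e ^ r * e ^ r) * (e ^ r) ^ 2 := by
        rw [← pow_mul, mul_comm 4 r, pow_mul]; ring
      rw [this]
      have : N ^ 2 ≤ (e ^ r) ^ 2 := by gcongr
      nlinarith [sq_nonneg N]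
    calc (2 ^ 20 * A0 ^ 2 * r ^ 2) ^ r * (3 * N ^ 2) * B
        ≤ (2 ^ 20 * A0 ^ 2 * r ^ 2) ^ r * (e ^ 4) ^ r * B := by gcongr
      _ = (2 ^ 20 * A0 ^ 2 * r ^ 2 * e ^ 4 * (e ^ 2 / δ ^ 2)) ^ r := by
          rw [hB, ← mul_pow, ← mul_pow]
      _ ≤ (δ ^ 2 * (e ^ 2)⁻¹) ^ r := by
          refine pow_le_pow_left₀ (by positivity) ?_ _
          rw [← div_eq_mul_inv, le_div_iff₀ (by positivity)]
          have : 2 ^ 20 * A0 ^ 2 * r ^ 2 * e ^ 4 * (e ^ 2 / δ ^ 2) * e ^ 2 =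
              2 ^ 20 * A0 ^ 2 * r ^ 2 * e ^ 8 / δ ^ 2 := by ring
          rw [this, div_le_iff₀ (by positivity)]
          linarith [hkey2, show δ ^ 2 * δ ^ 2 = δ ^ 4 by ring]
      _ = _ := by rw [mul_pow, pow_mul]
  have h8 : P ≤ 2 * ((e ^ 2)⁻¹) ^ r := by
    rw [hBi] at h6
    refine le_of_mul_le_mul_left ?_ hδr
    linarith
  refine h8.trans ?_
  have h9 : ((e ^ 2)⁻¹) ^ r = (e ^ r * e ^ r)⁻¹ := by
    rw [inv_pow, ← pow_mul, mul_comm 2 r, pow_mul, sq]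
  rw [h9, ← div_eq_mul_inv, div_le_iff₀ (by positivity), ← div_eq_inv_mul, le_div_iff₀ hN0]
  nlinarith

end Tail

open MeasureTheory ProbabilityTheory Matrix

/-! ### Reduction of the `s`-norm to real sparse vectors -/

section Reduce
variable {ι κ : Type*} [Fintype ι] [Fintype κ] [DecidableEq ι]

/-- Complex action of a real matrix, split into real and imaginary parts. -/
lemma cplx_form (P : Matrix κ ι ℝ) (w : ι → ℂ) :
    dotProduct (star w) (((1 - Pᵀ * P).map Complex.ofReal).mulVec w) =
      (((∑ i, (w i).re ^ 2) - ∑ j, (P *ᵥ fun i => (w i).re) j ^ 2 +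
        ((∑ i, (w i).im ^ 2) - ∑ j, (P *ᵥ fun i => (w i).im) j ^ 2) : ℝ) : ℂ) := by
  set C : Matrix κ ι ℂ := P.map Complex.ofReal with hC
  have hM : (1 - Pᵀ * P).map Complex.ofReal = 1 - Cᴴ * C := by
    ext i j
    simp only [map_apply, Matrix.sub_apply, Matrix.mul_apply, transpose_apply, conjTranspose_apply, hC,
      Complex.ofReal_sub, Complex.ofReal_sum, Complex.ofReal_mul, Complex.star_def,
      Complex.conj_ofReal, one_apply]
    split_ifs <;> simp
  have hself : ∀ {α : Type _} [Fintype α] (v : α → ℂ), star v ⬝ᵥ v =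
      ((∑ i, (v i).re ^ 2 + ∑ i, (v i).im ^ 2 : ℝ) : ℂ) := by
    intro α _ v
    rw [← Finset.sum_add_distrib, Complex.ofReal_sum]
    refine Finset.sum_congr rfl fun i _ => ?_
    rw [Pi.star_apply, Complex.star_def, ← Complex.normSq_eq_conj_mul_self, Complex.normSq_apply]
    push_cast; ring
  have hre : ∀ j, ((C *ᵥ w) j).re = (P *ᵥ fun i => (w i).re) j := by
    intro j; simp [hC, mulVec, dotProduct]
  have him : ∀ j, ((C *ᵥ w) j).im = (P *ᵥ fun i => (w i).im) j := by
    intro j; simp [hC, mulVec, dotProduct]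
  have h2 : star w ⬝ᵥ (Cᴴ * C) *ᵥ w = star (C *ᵥ w) ⬝ᵥ (C *ᵥ w) := by
    rw [star_mulVec, ← dotProduct_mulVec, mulVec_mulVec]
  have hs1 : star (C *ᵥ w) ⬝ᵥ (C *ᵥ w) =
      ((∑ i, ((C *ᵥ w) i).re ^ 2 + ∑ i, ((C *ᵥ w) i).im ^ 2 : ℝ) : ℂ) := by
    rw [← Finset.sum_add_distrib, Complex.ofReal_sum]
    refine Finset.sum_congr rfl fun i _ => ?_
    rw [Pi.star_apply, Complex.star_def, ← Complex.normSq_eq_conj_mul_self, Complex.normSq_apply]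
    push_cast; ring
  rw [hM, sub_mulVec, one_mulVec, dotProduct_sub, h2, hs1, hself w, ← Complex.ofReal_sub]
  simp_rw [hre, him]
  congr 1
  ring

lemma form_bound (P : Matrix κ ι ℝ) (s : ℕ) (δ : ℝ) (hδ : 0 ≤ δ)
    (h : ∀ (Γ : Finset ι) (z : ι → ℝ), Γ.card ≤ s → (∀ i, i ∉ Γ → z i = 0) → ∑ i, z i ^ 2 ≤ 1 →
      |∑ j, (P *ᵥ z) j ^ 2 - ∑ i, z i ^ 2| ≤ δ)
    (Γ : Finset ι) (hΓ : Γ.card ≤ s) (z : ι → ℝ) (hz : ∀ i, i ∉ Γ → z i = 0) :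
    |∑ j, (P *ᵥ z) j ^ 2 - ∑ i, z i ^ 2| ≤ δ * ∑ i, z i ^ 2 := by
  set q := ∑ i, z i ^ 2 with hq
  have hq0 : 0 ≤ q := Finset.sum_nonneg fun _ _ => sq_nonneg _
  rcases hq0.eq_or_lt with h0 | h0
  · have hz0 : z = 0 := by
      ext i
      have := (Finset.sum_eq_zero_iff_of_nonneg (fun i _ => sq_nonneg (z i))).mp (hq.symm.trans h0.symm) i
        (Finset.mem_univ i)
      simpa using this
    rw [← h0, hz0]; simp
  · have hs : Real.sqrt q ^ 2 = q := Real.sq_sqrt hq0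
    have hs0 : 0 < Real.sqrt q := Real.sqrt_pos.mpr h0
    set c := (Real.sqrt q)⁻¹ with hc
    have hc2 : c ^ 2 = q⁻¹ := by rw [hc, inv_pow, hs]
    have e1 : ∑ i, (c • z) i ^ 2 = 1 := by
      simp only [Pi.smul_apply, smul_eq_mul, mul_pow, ← Finset.mul_sum, ← hq, hc2]
      exact inv_mul_cancel₀ h0.ne'
    have e2 : ∑ j, (P *ᵥ (c • z)) j ^ 2 = q⁻¹ * ∑ j, (P *ᵥ z) j ^ 2 := by
      simp only [mulVec_smul, Pi.smul_apply, smul_eq_mul, mul_pow, ← Finset.mul_sum, hc2]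
    have := h Γ (c • z) hΓ (fun i hi => by simp [hz i hi]) e1.le
    rw [e1, e2] at this
    have e3 : ∑ j, (P *ᵥ z) j ^ 2 - q = q * (q⁻¹ * ∑ j, (P *ᵥ z) j ^ 2 - 1) := by
      field_simp
    rw [e3, abs_mul, abs_of_pos h0, mul_comm δ]
    exact mul_le_mul_of_nonneg_left this hq0

lemma polar (M : Matrix ι ι ℂ) (hM : M.IsHermitian) (x y : ι → ℂ) :
    (star (x + y) ⬝ᵥ M *ᵥ (x + y) - star (x - y) ⬝ᵥ M *ᵥ (x - y)).re = 4 * (star y ⬝ᵥ M *ᵥ x).re := by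
  have h : (star x ⬝ᵥ M *ᵥ y) = star (star y ⬝ᵥ M *ᵥ x) := by
    rw [star_dotProduct, star_mulVec, hM.eq, ← dotProduct_mulVec]
  have e : star (x + y) ⬝ᵥ M *ᵥ (x + y) - star (x - y) ⬝ᵥ M *ᵥ (x - y) =
      2 * (star y ⬝ᵥ M *ᵥ x) + 2 * (star x ⬝ᵥ M *ᵥ y) := by
    simp only [star_add, star_sub, mulVec_add, mulVec_sub, add_dotProduct, sub_dotProduct,
      dotProduct_add, dotProduct_sub]
    ring
  rw [e, h]
  simp
  ring

lemma snormS_le (P : Matrix κ ι ℝ) (s : ℕ) (δ : ℝ) (hδ : 0 ≤ δ)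
    (h : ∀ (Γ : Finset ι) (z : ι → ℝ), Γ.card ≤ s → (∀ i, i ∉ Γ → z i = 0) → ∑ i, z i ^ 2 ≤ 1 →
      |∑ j, (P *ᵥ z) j ^ 2 - ∑ i, z i ^ 2| ≤ δ) :
    snormS s ((1 - Pᵀ * P).map Complex.ofReal) ≤ δ := by
  refine Real.sSup_le ?_ hδ
  rintro _ ⟨Γ, x, y, hΓ, hx, hy, hx1, hy1, rfl⟩
  set M := (1 - Pᵀ * P).map Complex.ofReal with hM
  have hH : M.IsHermitian := by
    have h1 : (1 - Pᵀ * P).IsSymm := by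
      rw [IsSymm, transpose_sub, transpose_one, transpose_mul, transpose_transpose]
    ext i j
    simp only [hM, conjTranspose_apply, map_apply, Complex.star_def, Complex.conj_ofReal]
    rw [h1.apply]
  have hB := form_bound P s δ hδ h
  have hq : ∀ w : ι → ℂ, (∀ i, i ∉ Γ → w i = 0) →
      |(star w ⬝ᵥ M *ᵥ w).re| ≤ δ * ∑ i, ‖w i‖ ^ 2 := by
    intro w hw
    rw [hM, cplx_form, Complex.ofReal_re]
    have a1 := hB Γ hΓ (fun i => (w i).re) (fun i hi => by simp [hw i hi])
    have a2 := hB Γ hΓ (fun i => (w i).im) (fun i hi => by simp [hw i hi])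
    have e : ∑ i, ‖w i‖ ^ 2 = ∑ i, (w i).re ^ 2 + ∑ i, (w i).im ^ 2 := by
      rw [← Finset.sum_add_distrib]
      refine Finset.sum_congr rfl fun i _ => ?_
      rw [Complex.sq_norm, Complex.normSq_apply]; ring
    rw [e, mul_add]
    rw [abs_sub_comm] at a1 a2
    exact (abs_add_le _ _).trans (add_le_add a1 a2)
  -- phase
  obtain ⟨u, hu, hu2⟩ : ∃ u : ℂ, ‖u‖ = 1 ∧ u * (star y ⬝ᵥ M *ᵥ x) = ‖star y ⬝ᵥ M *ᵥ x‖ := by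
    by_cases h0 : star y ⬝ᵥ M *ᵥ x = 0
    · exact ⟨1, by simp, by simp [h0]⟩
    · set ζ := star y ⬝ᵥ M *ᵥ x
      have hn : (‖ζ‖ : ℂ) ≠ 0 := by simpa using h0
      refine ⟨‖ζ‖ / ζ, ?_, by field_simp⟩
      rw [norm_div, Complex.norm_real, norm_norm, div_self (by simpa using h0)]
  have hux : star y ⬝ᵥ M *ᵥ (u • x) = ‖star y ⬝ᵥ M *ᵥ x‖ := by
    rw [mulVec_smul, dotProduct_smul, smul_eq_mul, hu2]
  have hp := polar M hH (u • x) y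
  rw [hux, Complex.ofReal_re, Complex.sub_re] at hp
  have b1 := hq (u • x + y) (fun i hi => by simp [hx i hi, hy i hi])
  have b2 := hq (u • x - y) (fun i hi => by simp [hx i hi, hy i hi])
  have par : ∑ i, ‖(u • x + y) i‖ ^ 2 + ∑ i, ‖(u • x - y) i‖ ^ 2 = 4 := by
    rw [← Finset.sum_add_distrib]
    have : ∀ i, ‖(u • x + y) i‖ ^ 2 + ‖(u • x - y) i‖ ^ 2 = 2 * (‖x i‖ ^ 2 + ‖y i‖ ^ 2) := by
      intro i
      have := parallelogram_law_with_norm ℝ (u * x i) (y i)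
      simp only [Pi.add_apply, Pi.sub_apply, Pi.smul_apply, smul_eq_mul]
      rw [norm_mul, hu, one_mul] at this
      nlinarith
    simp_rw [this]
    rw [← Finset.mul_sum, Finset.sum_add_distrib, hx1, hy1]; norm_num
  have c1 := (abs_le.mp b1).2
  have c2 := (abs_le.mp b2).1
  nlinarith

lemma sparse_l1 (s : ℕ) (Γ : Finset ι) (hΓ : Γ.card ≤ s) (z : ι → ℝ) (hz : ∀ i, i ∉ Γ → z i = 0)
    (h : ∑ i, z i ^ 2 ≤ 1) : ∑ i, |z i| ≤ Real.sqrt s := by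
  refine Real.le_sqrt_of_sq_le ?_
  have e : ∑ i, |z i| = ∑ i ∈ Γ, |z i| := by
    refine (Finset.sum_subset (Finset.subset_univ _) fun i _ hi => ?_).symm
    rw [hz i hi, abs_zero]
  rw [e]
  calc (∑ i ∈ Γ, |z i|) ^ 2 ≤ Γ.card * ∑ i ∈ Γ, |z i| ^ 2 := sq_sum_le_card_mul_sum_sq
    _ ≤ s * 1 := by
        have h2 : ∑ i ∈ Γ, |z i| ^ 2 ≤ 1 := by
          simp_rw [sq_abs]
          exact (Finset.sum_le_sum_of_subset_of_nonneg (Finset.subset_univ _)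
            fun _ _ _ => sq_nonneg _).trans h
        have h3 : (Γ.card : ℝ) ≤ s := by exact_mod_cast hΓ
        have h4 : (0:ℝ) ≤ ∑ i ∈ Γ, |z i| ^ 2 := Finset.sum_nonneg fun _ _ => sq_nonneg _
        nlinarith [(Nat.cast_nonneg Γ.card : (0:ℝ) ≤ Γ.card)]
    _ = s := mul_one _

end Reduce

lemma act_cont {p n m : ℕ} (φ : Fin p → Fin m → ℝ) : Continuous (fun z => nrm p n m φ z) := by
  unfold nrm act
  fun_prop

lemma main_bound {p n m : ℕ} [NeZero m] (hn : 1 ≤ n) (hnm : n ≤ m) (hmN : m ≤ n * p)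
    (hN2 : 2 ≤ n * p) (s : ℕ) (hs : 1 ≤ s) (δ : ℝ) (hδ : 0 < δ) (hδ1 : δ ≤ 1)
    (hbig : 10 ^ 18 * δ⁻¹ ^ 2 * s * (Real.log ((n : ℝ) * p)) ^ 6 ≤ m) :
    (gaussMeasure p m {φ | snormS s ((1 - (probeMatrix p n m φ)ᵀ * probeMatrix p n m φ).map
      Complex.ofReal) > δ}).toReal ≤ ((n : ℝ) * p)⁻¹ := by
  set T : Set (Fin p × Fin n → ℝ) := {z | ∃ Γ : Finset (Fin p × Fin n), Γ.card ≤ s ∧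
    (∀ i, i ∉ Γ → z i = 0) ∧ ∑ i, z i ^ 2 ≤ 1} with hT
  have : Nonempty T := ⟨⟨0, ∅, by simp, by simp, by simp⟩⟩
  let d : ℕ → T := TopologicalSpace.denseSeq T
  have hd : DenseRange d := TopologicalSpace.denseRange_denseSeq T
  let z : ∀ k : ℕ, Fin (k + 1) → Fin p × Fin n → ℝ := fun k b => (d b : Fin p × Fin n → ℝ)
  let A : ℕ → Set (Fin p → Fin m → ℝ) := fun k => {φ | δ < Xf p n m (z k) φ}
  have hA : ∀ k, gaussMeasure p m (A k) ≤ ENNReal.ofReal (((n : ℝ) * p)⁻¹) := by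
    intro k
    have := tail hn hnm hmN hN2 s hs δ hδ hδ1 hbig (z k)
      (fun b => by
        obtain ⟨Γ, h1, h2, h3⟩ := (d b).2
        exact sparse_l1 s Γ h1 _ h2 h3)
      (fun b => by
        obtain ⟨Γ, h1, h2, h3⟩ := (d b).2
        exact h3)
    rw [← ENNReal.ofReal_toReal (measure_ne_top (gaussMeasure p m) (A k))]
    exact ENNReal.ofReal_le_ofReal this
  have hXf : ∀ k φ, δ < Xf p n m (z k) φ ↔
      ∃ b : Fin (k + 1), δ < |nrm p n m φ (d b) - ∑ ik, (d b : Fin p × Fin n → ℝ) ik ^ 2| := by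
    intro k φ
    rw [← not_iff_not]
    push Not
    unfold Xf
    rw [pi_norm_le_iff_of_nonneg hδ.le]
    rfl
  have hmono : Monotone A := by
    intro k l hkl φ hφ
    obtain ⟨b, hb⟩ := (hXf k φ).mp hφ
    exact (hXf l φ).mpr ⟨⟨b, by omega⟩, hb⟩
  have hsub : {φ | snormS s ((1 - (probeMatrix p n m φ)ᵀ * probeMatrix p n m φ).map
      Complex.ofReal) > δ} ⊆ ⋃ k, A k := by
    intro φ hφ
    by_contra hcon
    simp only [Set.mem_iUnion, not_exists] at hcon
    refine absurd hφ (not_lt.mpr (snormS_le _ s δ hδ.le ?_))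
    intro Γ w h1 h2 h3
    have hclosed : IsClosed {t : T | |nrm p n m φ t - ∑ ik, (t : Fin p × Fin n → ℝ) ik ^ 2| ≤ δ} := by
      refine isClosed_le ?_ continuous_const
      have := (act_cont (n := n) φ).comp (continuous_subtype_val (p := T.Mem))
      refine Continuous.abs (Continuous.sub this ?_)
      refine continuous_finsetSum _ fun ik _ => Continuous.pow ?_ 2
      exact (continuous_apply ik).comp continuous_subtype_val
    have hall : ∀ t : T, |nrm p n m φ t - ∑ ik, (t : Fin p × Fin n → ℝ) ik ^ 2| ≤ δ := by
      intro t
      refine hd.induction_on (p := fun t : T => |nrm p n m φ t - ∑ ik, (t : Fin p × Fin n → ℝ) ik ^ 2| ≤ δ) t hclosed fun k => ?_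
      by_contra hk
      exact hcon k ((hXf k φ).mpr ⟨⟨k, by omega⟩, not_le.mp hk⟩)
    have := hall ⟨w, Γ, h1, h2, h3⟩
    rw [act_eq]
    exact this
  have hfin : gaussMeasure p m {φ | snormS s ((1 - (probeMatrix p n m φ)ᵀ * probeMatrix p n m φ).map
      Complex.ofReal) > δ} ≤ ENNReal.ofReal (((n : ℝ) * p)⁻¹) := by
    refine (measure_mono hsub).trans ?_
    rw [hmono.measure_iUnion]
    exact iSup_le hA
  refine (ENNReal.toReal_mono ENNReal.ofReal_ne_top hfin).trans (le_of_eq ?_)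
  exact ENNReal.toReal_ofReal (by positivity)

theorem stmt2 : ∃ C8 C9 : ℝ, 0 < C8 ∧ 0 < C9 ∧
    ∀ (p n m s : ℕ) (δ : ℝ), 1 ≤ p → 2 ≤ n → n ≤ m → m ≤ n * p → 2 ≤ s → s ≤ n * p →
    0 < δ → δ ≤ 1 →
    C9 * δ⁻¹ ^ 2 * s * (Real.log ((n : ℝ) * p)) ^ 6 ≤ m →
    (gaussMeasure p m {φ |
        snormS s ((1 - (probeMatrix p n m φ)ᵀ * probeMatrix p n m φ).map Complex.ofReal)
          > δ}).toReal
      ≤ C8 * (((n : ℝ) * p))⁻¹ := by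
  refine ⟨1, 10 ^ 18, one_pos, by positivity, ?_⟩
  intro p n m s δ hp hn hnm hmN hs _ hδ hδ1 hbig
  have : NeZero m := ⟨by omega⟩
  rw [one_mul]
  exact main_bound (by omega) hnm hmN (by omega) s (by omega) δ hδ hδ1 hbig
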